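/- arXiv:2511.20212 — 3 statements merged into one kernel-verified Lean document; each statement's English description precedes it below -/
import Mathlib

section
/- Apply the layered spin-configuration setup to the graph H = G' with n = |V(G')| = 211n0² + n0 + 1 vertices. Take mixer angles β_ℓ = ψ for 1 ≤ ℓ ≤ p−2 and β_{p−1} = β_p = π/4, where ψ = 2^{−⌈n²/2⌉}. For each integer k define the Laurent coefficient w(k) = Σ_{z : D(z)=k} z_{x_0}^[0] · z_{y_0}^[0] · Π_{x∈V(G')} f(z_x), the sum ranging over all layered spin configurations z on V(G') with exponent k. Let D_max = (p−1)·MAXCUT(G') + 200n0² + 2n0(11n0+1). Then, for all sufficiently large n0, w(k) = 0 for every integer k > D_max, and w(D_max) ≠ 0; that is, D_max is the largest exponent with nonzero coefficient. -/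
/-!
STATEMENT 3: the largest exponent with nonzero Laurent coefficient. For the
gadget graph G′ (with n = 211 n₀² + n₀ + 1 vertices), mixer angles β_ℓ = ψ
(1 ≤ ℓ ≤ p-2), β_{p-1} = β_p = π/4, and ψ = 2^{-⌈n²/2⌉}, the coefficients
w(k) = Σ_{D(z)=k} z_{x₀}^{[0]} z_{y₀}^{[0]} ∏_x f(z_x) vanish for all
k > D_max = (p-1)·MAXCUT(G′) + 200 n₀² + 2 n₀(11 n₀ + 1), while w(D_max) ≠ 0,
for all sufficiently large n₀.
-/
noncomputable section

namespace QAOA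

/-- Vertex type of the graph `G'` built from a graph on vertex type `V` of size `n0`:
gadget vertices `L u i` (`i < n0+1`), `R u i` (`i < 10 n0`), frame vertices
`X i`, `Y i` (`i < 100 n0²`), and the controller `W`. -/
inductive GPV (V : Type) (n0 : ℕ) : Type where
  | L : V → Fin (n0 + 1) → GPV V n0
  | R : V → Fin (10 * n0) → GPV V n0
  | X : Fin (100 * n0 * n0) → GPV V n0
  | Y : Fin (100 * n0 * n0) → GPV V n0
  | W : GPV V n0
  deriving DecidableEq, Fintype

/-- Base relation (one orientation per edge) describing the edges of `G'`. -/
def gpRel {V : Type} [DecidableEq V] (n0 : ℕ) (G : SimpleGraph V) [DecidableRel G.Adj] :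
    GPV V n0 → GPV V n0 → Bool
  | .L u _, .R v _ => u == v
  | .L u i, .L v j => decide (G.Adj u v) && ((i : ℕ) == (j : ℕ))
  | .X _, .Y _ => true
  | .X i, .L _ _ => (i : ℕ) == 0
  | .X i, .R _ _ => (i : ℕ) == 0
  | .Y i, .L _ _ => (i : ℕ) == 0
  | .Y i, .R _ _ => (i : ℕ) == 0
  | .W, .X i => (i : ℕ) == 0
  | .W, .Y i => (i : ℕ) == 0
  | .W, .L _ i => (i : ℕ) == 0
  | _, _ => false

/-- The graph `G'` obtained from `G` by the four-step construction. -/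
def Gp {V : Type} [DecidableEq V] (n0 : ℕ) (G : SimpleGraph V) [DecidableRel G.Adj] :
    SimpleGraph (GPV V n0) :=
  SimpleGraph.fromRel (fun a b => gpRel n0 G a b = true)

instance {V : Type} [DecidableEq V] (n0 : ℕ) (G : SimpleGraph V) [DecidableRel G.Adj] :
    DecidableRel (Gp n0 G).Adj := fun a b =>
  decidable_of_iff _ (SimpleGraph.fromRel_adj (fun a b => gpRel n0 G a b = true) a b).symm

/-- The special frame vertex `x₀`. -/
def xzero (V : Type) (n0 : ℕ) (h : 0 < n0) : GPV V n0 :=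
  GPV.X ⟨0, Nat.mul_pos (Nat.mul_pos (by norm_num) h) h⟩

/-- The special frame vertex `y₀`. -/
def yzero (V : Type) (n0 : ℕ) (h : 0 < n0) : GPV V n0 :=
  GPV.Y ⟨0, Nat.mul_pos (Nat.mul_pos (by norm_num) h) h⟩

/-- `cutSet H S` is the number of edges of `H` with exactly one endpoint in `S`. -/
def cutSet {W : Type} [Fintype W] [DecidableEq W] (H : SimpleGraph W) [DecidableRel H.Adj]
    (S : Finset W) : ℕ :=
  (Finset.univ.filter (fun pr : W × W => H.Adj pr.1 pr.2 ∧ pr.1 ∈ S ∧ pr.2 ∉ S)).card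

/-- `maxCut H` is the maximum of `cutSet H S` over all vertex subsets `S`. -/
def maxCut {W : Type} [Fintype W] [DecidableEq W] (H : SimpleGraph W) [DecidableRel H.Adj] : ℕ :=
  (Finset.univ : Finset (Finset W)).sup (fun S => cutSet H S)

end QAOA
namespace QAOA

/-- Map a layer index `j ∈ {-p,…,p}` to an index in `Fin (2p+1)` (via `j ↦ j + p`). -/
def lay (p : ℕ) (j : ℤ) : Fin (2 * p + 1) :=
  ⟨(j + p).toNat % (2 * p + 1), Nat.mod_lt _ (by omega)⟩

/-- One-qubit mixer matrix element `m(β; a, b)`: `cos β` if `a = b`, `i sin β` otherwise. -/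
noncomputable def mElem (β : ℝ) (a b : ℤˣ) : ℂ :=
  if a = b then (Real.cos β : ℂ) else Complex.I * (Real.sin β : ℂ)

/-- Conjugated mixer matrix element `m̄(β; a, b)`: `cos β` if `a = b`, `-i sin β` otherwise. -/
noncomputable def mElemBar (β : ℝ) (a b : ℤˣ) : ℂ :=
  if a = b then (Real.cos β : ℂ) else -(Complex.I * (Real.sin β : ℂ))

/-- The one-site kernel `f(z_x)` of a vertex, given its layered spins
`zx : Fin (2p+1) → ℤˣ` and the mixer angles `β`. -/
noncomputable def kernel (p : ℕ) (β : ℕ → ℝ) (zx : Fin (2 * p + 1) → ℤˣ) : ℂ :=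
  (1 / 2 : ℂ)
    * (∏ ℓ ∈ Finset.Icc 1 (p - 1), mElem (β ℓ) (zx (lay p ℓ)) (zx (lay p (ℓ + 1))))
    * mElem (β p) (zx (lay p p)) (zx (lay p 0))
    * mElemBar (β p) (zx (lay p 0)) (zx (lay p (-(p : ℤ))))
    * (∏ ℓ ∈ Finset.Icc 1 (p - 1),
        mElemBar (β ℓ) (zx (lay p (-(ℓ : ℤ) - 1))) (zx (lay p (-(ℓ : ℤ)))))

/-- `layerCut H p z j` is the number of edges of `H` whose endpoints get different
signs on layer `j` (each unordered edge counted once). -/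
def layerCut {W : Type} [Fintype W] [DecidableEq W] (H : SimpleGraph W) [DecidableRel H.Adj]
    (p : ℕ) (z : W → Fin (2 * p + 1) → ℤˣ) (j : ℤ) : ℕ :=
  (Finset.univ.filter (fun pr : W × W =>
      H.Adj pr.1 pr.2 ∧ z pr.1 (lay p j) ≠ z pr.2 (lay p j))).card / 2

/-- The exponent `D(z) = Σ_{j=1}^p (C_j(z) - C_{-j}(z))` of a layered configuration. -/
def expnt {W : Type} [Fintype W] [DecidableEq W] (H : SimpleGraph W) [DecidableRel H.Adj]
    (p : ℕ) (z : W → Fin (2 * p + 1) → ℤˣ) : ℤ :=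
  ∑ j ∈ Finset.Icc 1 p, ((layerCut H p z (j : ℤ) : ℤ) - (layerCut H p z (-(j : ℤ)) : ℤ))

/-- The monomial contribution `z_a^{[0]} z_b^{[0]} ∏_x f(z_x)` of a configuration. -/
noncomputable def coeffTerm {W : Type} [Fintype W] [DecidableEq W] (p : ℕ) (β : ℕ → ℝ)
    (a b : W) (z : W → Fin (2 * p + 1) → ℤˣ) : ℂ :=
  ((z a (lay p 0) : ℤ) : ℂ) * ((z b (lay p 0) : ℤ) : ℂ) * ∏ x, kernel p β (z x)

/-- The mixer angles used in the reduction: `β_ℓ = ψ` for `1 ≤ ℓ ≤ p-2` and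
`β_{p-1} = β_p = π/4`. -/
noncomputable def betaAngles (p : ℕ) (ψ : ℝ) : ℕ → ℝ := fun ℓ =>
  if ℓ = p - 1 ∨ ℓ = p then Real.pi / 4 else ψ

end QAOA

namespace QAOA

section Cut

variable {W : Type} [Fintype W] [DecidableEq W] (H : SimpleGraph W) [DecidableRel H.Adj]

/-- The number of edges of `H` whose endpoints carry different spins in `c`. -/
def spinCut (c : W → ℤˣ) : ℕ := cutSet H (Finset.univ.filter fun x => c x = 1)

/-- The Ising sum of `c` over ordered pairs of adjacent vertices. -/
def bondSum (c : W → ℤˣ) : ℤ :=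
  ∑ a, ∑ b, if H.Adj a b then (c a : ℤ) * (c b : ℤ) else 0

theorem units_sq (s : ℤˣ) : (s : ℤ) * (s : ℤ) = 1 := by
  rcases Int.units_eq_one_or s with h | h <;> simp [h]

theorem card_unequal_pairs (c : W → ℤˣ) :
    (Finset.univ.filter (fun pr : W × W => H.Adj pr.1 pr.2 ∧ c pr.1 ≠ c pr.2)).card
      = 2 * spinCut H c := by
  have hswap : (Finset.univ.filter (fun pr : W × W =>
      H.Adj pr.1 pr.2 ∧ ¬ c pr.1 = 1 ∧ c pr.2 = 1)).card = spinCut H c := by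
    unfold spinCut cutSet
    refine Finset.card_bij' (fun pr _ => pr.swap) (fun pr _ => pr.swap) ?_ ?_ ?_ ?_ <;>
      simp +contextual [SimpleGraph.adj_comm]
  rw [two_mul]
  nth_rewrite 2 [← hswap]
  unfold spinCut cutSet
  rw [← Finset.card_union_of_disjoint]
  · congr 1
    ext ⟨a, b⟩
    rcases Int.units_eq_one_or (c a) with h | h <;> rcases Int.units_eq_one_or (c b) with h' | h' <;>
      simp [h, h']
  · rw [Finset.disjoint_left]
    simp +contextual

theorem layerCut_eq_spinCut (p : ℕ) (z : W → Fin (2 * p + 1) → ℤˣ) (j : ℤ) :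
    layerCut H p z j = spinCut H (fun x => z x (lay p j)) := by
  unfold layerCut
  rw [card_unequal_pairs H (fun x => z x (lay p j))]
  omega

theorem four_mul_spinCut (c : W → ℤˣ) :
    4 * (spinCut H c : ℤ) = ∑ a, ∑ b, if H.Adj a b then 1 - (c a : ℤ) * (c b : ℤ) else 0 := by
  have h := card_unequal_pairs H c
  have h2 : 4 * (spinCut H c : ℤ) = 2 * ((Finset.univ.filter
      (fun pr : W × W => H.Adj pr.1 pr.2 ∧ c pr.1 ≠ c pr.2)).card : ℤ) := by
    rw [h]; push_cast; ring
  rw [h2, Finset.card_filter, ← Finset.univ_product_univ, Finset.sum_product]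
  push_cast
  simp only [Finset.mul_sum]
  refine Finset.sum_congr rfl fun a _ => Finset.sum_congr rfl fun b _ => ?_
  by_cases hab : H.Adj a b
  · rcases Int.units_eq_one_or (c a) with h | h <;>
      rcases Int.units_eq_one_or (c b) with h' | h' <;> simp [hab, h, h']
  · simp [hab]

theorem four_mul_spinCut_eq_sub (c : W → ℤˣ) :
    4 * (spinCut H c : ℤ) = bondSum H 1 - bondSum H c := by
  rw [four_mul_spinCut, bondSum, bondSum, ← Finset.sum_sub_distrib]
  refine Finset.sum_congr rfl fun a _ => ?_
  rw [← Finset.sum_sub_distrib]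
  refine Finset.sum_congr rfl fun b _ => ?_
  split_ifs <;> simp

theorem spinCut_le_maxCut (c : W → ℤˣ) : spinCut H c ≤ maxCut H :=
  Finset.le_sup (f := fun S => cutSet H S) (Finset.mem_univ _)

theorem exists_spinCut_eq_maxCut : ∃ c : W → ℤˣ, spinCut H c = maxCut H := by
  obtain ⟨S, -, hS⟩ := Finset.exists_mem_eq_sup (Finset.univ : Finset (Finset W))
    Finset.univ_nonempty (fun S => cutSet H S)
  refine ⟨fun x => if x ∈ S then 1 else -1, ?_⟩
  rw [maxCut, hS, spinCut]
  congr 1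
  ext x
  by_cases hx : x ∈ S <;> simp [hx]

theorem spinCut_neg (c : W → ℤˣ) : spinCut H (fun x => -c x) = spinCut H c := by
  have h1 := four_mul_spinCut H c
  have h2 := four_mul_spinCut H (fun x => -c x)
  simp only [Units.val_neg, neg_mul_neg] at h2
  omega

theorem spinCut_const (s : ℤˣ) : spinCut H (fun _ => s) = 0 := by
  have h := four_mul_spinCut H (fun _ => s)
  simp only [units_sq, sub_self, ite_self, Finset.sum_const_zero] at h
  omega

theorem eq_of_spinCut_eq_zero {c : W → ℤˣ} (hc : spinCut H c = 0) {a b : W} (hab : H.Adj a b) :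
    c a = c b := by
  have h := card_unequal_pairs H c
  rw [hc, mul_zero, Finset.card_eq_zero, Finset.filter_eq_empty_iff] at h
  by_contra hne
  exact h (Finset.mem_univ (a, b)) ⟨hab, hne⟩

theorem spinCut_mul_defect (χ v : W → ℤˣ) :
    4 * ((spinCut H v : ℤ) + spinCut H χ - spinCut H (fun x => χ x * v x)) =
      ∑ a, ∑ b, if H.Adj a b then
        (1 - (v a : ℤ) * (v b : ℤ)) * (1 - (χ a : ℤ) * (χ b : ℤ)) else 0 := by
  have h : 4 * ((spinCut H v : ℤ) + spinCut H χ - spinCut H (fun x => χ x * v x))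
      = 4 * (spinCut H v : ℤ) + 4 * (spinCut H χ : ℤ)
        - 4 * (spinCut H (fun x => χ x * v x) : ℤ) := by ring
  rw [h, four_mul_spinCut, four_mul_spinCut, four_mul_spinCut,
    ← Finset.sum_add_distrib, ← Finset.sum_sub_distrib]
  refine Finset.sum_congr rfl fun a _ => ?_
  rw [← Finset.sum_add_distrib, ← Finset.sum_sub_distrib]
  refine Finset.sum_congr rfl fun b _ => ?_
  split_ifs
  · push_cast; ring
  · simp

theorem one_sub_units_mul_nonneg (s t : ℤˣ) : 0 ≤ 1 - (s : ℤ) * (t : ℤ) := by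
  rcases Int.units_eq_one_or s with h | h <;> rcases Int.units_eq_one_or t with h' | h' <;>
    simp [h, h']

theorem spinCut_mul_le (χ v : W → ℤˣ) :
    (spinCut H (fun x => χ x * v x) : ℤ) ≤ spinCut H v + spinCut H χ := by
  have h := spinCut_mul_defect H χ v
  have h0 : 0 ≤ ∑ a, ∑ b, if H.Adj a b then
        (1 - (v a : ℤ) * (v b : ℤ)) * (1 - (χ a : ℤ) * (χ b : ℤ)) else 0 := by
    refine Finset.sum_nonneg fun a _ => Finset.sum_nonneg fun b _ => ?_
    split_ifs
    · exact mul_nonneg (one_sub_units_mul_nonneg _ _) (one_sub_units_mul_nonneg _ _)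
    · exact le_rfl
  linarith

theorem eq_of_spinCut_mul_eq {χ v : W → ℤˣ}
    (h : (spinCut H (fun x => χ x * v x) : ℤ) = spinCut H v + spinCut H χ)
    {a b : W} (hab : H.Adj a b) (hχ : χ a ≠ χ b) : v a = v b := by
  have h1 := spinCut_mul_defect H χ v
  have hnn : ∀ a b, 0 ≤ if H.Adj a b then
        (1 - (v a : ℤ) * (v b : ℤ)) * (1 - (χ a : ℤ) * (χ b : ℤ)) else 0 := by
    intro a b
    split_ifs
    · exact mul_nonneg (one_sub_units_mul_nonneg _ _) (one_sub_units_mul_nonneg _ _)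
    · exact le_rfl
  rw [h, sub_self, mul_zero, eq_comm,
    Finset.sum_eq_zero_iff_of_nonneg fun a _ => Finset.sum_nonneg fun b _ => hnn a b] at h1
  have h2 := h1 a (Finset.mem_univ a)
  rw [Finset.sum_eq_zero_iff_of_nonneg fun b _ => hnn a b] at h2
  have h3 := h2 b (Finset.mem_univ b)
  rw [if_pos hab] at h3
  rcases Int.units_eq_one_or (v a) with e1 | e1 <;> rcases Int.units_eq_one_or (v b) with e2 | e2 <;>
    rcases Int.units_eq_one_or (χ a) with e3 | e3 <;>
    rcases Int.units_eq_one_or (χ b) with e4 | e4 <;> simp_all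

end Cut

section Gadget

variable {V : Type} {n0 : ℕ}

/-- The vertices of `G'` as a disjoint sum of its five blocks. -/
def gpvEquiv (V : Type) (n0 : ℕ) : GPV V n0 ≃
    (V × Fin (n0 + 1)) ⊕ (V × Fin (10 * n0)) ⊕ Fin (100 * n0 * n0) ⊕ Fin (100 * n0 * n0) ⊕ Unit where
  toFun
    | .L u i => .inl (u, i)
    | .R u i => .inr (.inl (u, i))
    | .X i => .inr (.inr (.inl i))
    | .Y i => .inr (.inr (.inr (.inl i)))
    | .W => .inr (.inr (.inr (.inr ())))
  invFun
    | .inl (u, i) => .L u i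
    | .inr (.inl (u, i)) => .R u i
    | .inr (.inr (.inl i)) => .X i
    | .inr (.inr (.inr (.inl i))) => .Y i
    | .inr (.inr (.inr (.inr ()))) => .W
  left_inv x := by cases x <;> rfl
  right_inv x := by rcases x with ⟨u, i⟩ | ⟨u, i⟩ | i | i | i <;> rfl

theorem sum_GPV [Fintype V] {M : Type*} [AddCommMonoid M] (f : GPV V n0 → M) :
    ∑ x, f x = (∑ u, ∑ i, f (.L u i)) + ((∑ u, ∑ i, f (.R u i)) +
      ((∑ i, f (.X i)) + ((∑ i, f (.Y i)) + f .W))) := by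
  rw [← (gpvEquiv V n0).symm.sum_comp]
  simp only [Fintype.sum_sum_type, Fintype.sum_prod_type]
  simp [gpvEquiv]

theorem card_GPV [Fintype V] (hV : Fintype.card V = n0) :
    Fintype.card (GPV V n0) = 211 * n0 ^ 2 + n0 + 1 := by
  rw [Fintype.card_congr (gpvEquiv V n0)]
  simp [hV]
  ring

variable [DecidableEq V] {G : SimpleGraph V} [DecidableRel G.Adj]

theorem adj_L_L {u v : V} {i j : Fin (n0 + 1)} :
    (Gp n0 G).Adj (.L u i) (.L v j) ↔ G.Adj u v ∧ i = j := by
  simp only [Gp, SimpleGraph.fromRel_adj, gpRel]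
  have := G.ne_of_adj (a := u) (b := v)
  have := G.adj_comm u v
  simp only [ne_eq, GPV.L.injEq, Bool.and_eq_true, decide_eq_true_eq, beq_iff_eq, Fin.val_inj]
  grind

theorem adj_R_R {u v : V} {i j : Fin (10 * n0)} : ¬ (Gp n0 G).Adj (.R u i) (.R v j) := by
  simp [Gp, gpRel]

theorem adj_X_X {i j : Fin (100 * n0 * n0)} : ¬ (Gp n0 G).Adj (.X i) (.X j) := by
  simp [Gp, gpRel]

theorem adj_Y_Y {i j : Fin (100 * n0 * n0)} : ¬ (Gp n0 G).Adj (.Y i) (.Y j) := by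
  simp [Gp, gpRel]

theorem adj_W_W : ¬ (Gp n0 G).Adj .W .W := by
  simp [Gp]

theorem adj_L_R {u v : V} {i : Fin (n0 + 1)} {j : Fin (10 * n0)} :
    (Gp n0 G).Adj (.L u i) (.R v j) ↔ u = v := by
  simp [Gp, gpRel]

theorem adj_X_Y {i j : Fin (100 * n0 * n0)} : (Gp n0 G).Adj (.X i) (.Y j) := by
  simp [Gp, gpRel]

theorem adj_X_L {i : Fin (100 * n0 * n0)} {u : V} {j : Fin (n0 + 1)} :
    (Gp n0 G).Adj (.X i) (.L u j) ↔ (i : ℕ) = 0 := by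
  simp [Gp, gpRel]

theorem adj_X_R {i : Fin (100 * n0 * n0)} {u : V} {j : Fin (10 * n0)} :
    (Gp n0 G).Adj (.X i) (.R u j) ↔ (i : ℕ) = 0 := by
  simp [Gp, gpRel]

theorem adj_Y_L {i : Fin (100 * n0 * n0)} {u : V} {j : Fin (n0 + 1)} :
    (Gp n0 G).Adj (.Y i) (.L u j) ↔ (i : ℕ) = 0 := by
  simp [Gp, gpRel]

theorem adj_Y_R {i : Fin (100 * n0 * n0)} {u : V} {j : Fin (10 * n0)} :
    (Gp n0 G).Adj (.Y i) (.R u j) ↔ (i : ℕ) = 0 := by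
  simp [Gp, gpRel]

theorem adj_W_X {i : Fin (100 * n0 * n0)} : (Gp n0 G).Adj .W (.X i) ↔ (i : ℕ) = 0 := by
  simp [Gp, gpRel]

theorem adj_W_Y {i : Fin (100 * n0 * n0)} : (Gp n0 G).Adj .W (.Y i) ↔ (i : ℕ) = 0 := by
  simp [Gp, gpRel]

theorem adj_W_L {u : V} {i : Fin (n0 + 1)} : (Gp n0 G).Adj .W (.L u i) ↔ (i : ℕ) = 0 := by
  simp [Gp, gpRel]

theorem adj_W_R {u : V} {i : Fin (10 * n0)} : ¬ (Gp n0 G).Adj .W (.R u i) := by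
  simp [Gp, gpRel]

theorem sum_ite_val_eq_zero {m : ℕ} (hm : 0 < m) (g : Fin m → ℤ) :
    (∑ i : Fin m, if (i : ℕ) = 0 then g i else 0) = g ⟨0, hm⟩ := by
  have h : ∀ i : Fin m, (i : ℕ) = 0 ↔ i = ⟨0, hm⟩ := fun i => by rw [Fin.ext_iff]
  simp [h]

theorem adj_R_L {u v : V} {i : Fin (10 * n0)} {j : Fin (n0 + 1)} :
    (Gp n0 G).Adj (.R u i) (.L v j) ↔ v = u := by
  rw [SimpleGraph.adj_comm, adj_L_R]

theorem adj_Y_X {i j : Fin (100 * n0 * n0)} : (Gp n0 G).Adj (.Y i) (.X j) := adj_X_Y.symm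

theorem adj_L_X {i : Fin (100 * n0 * n0)} {u : V} {j : Fin (n0 + 1)} :
    (Gp n0 G).Adj (.L u j) (.X i) ↔ (i : ℕ) = 0 := by
  rw [SimpleGraph.adj_comm, adj_X_L]

theorem adj_R_X {i : Fin (100 * n0 * n0)} {u : V} {j : Fin (10 * n0)} :
    (Gp n0 G).Adj (.R u j) (.X i) ↔ (i : ℕ) = 0 := by
  rw [SimpleGraph.adj_comm, adj_X_R]

theorem adj_L_Y {i : Fin (100 * n0 * n0)} {u : V} {j : Fin (n0 + 1)} :
    (Gp n0 G).Adj (.L u j) (.Y i) ↔ (i : ℕ) = 0 := by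
  rw [SimpleGraph.adj_comm, adj_Y_L]

theorem adj_R_Y {i : Fin (100 * n0 * n0)} {u : V} {j : Fin (10 * n0)} :
    (Gp n0 G).Adj (.R u j) (.Y i) ↔ (i : ℕ) = 0 := by
  rw [SimpleGraph.adj_comm, adj_Y_R]

theorem adj_X_W {i : Fin (100 * n0 * n0)} : (Gp n0 G).Adj (.X i) .W ↔ (i : ℕ) = 0 := by
  rw [SimpleGraph.adj_comm, adj_W_X]

theorem adj_Y_W {i : Fin (100 * n0 * n0)} : (Gp n0 G).Adj (.Y i) .W ↔ (i : ℕ) = 0 := by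
  rw [SimpleGraph.adj_comm, adj_W_Y]

theorem adj_L_W {u : V} {i : Fin (n0 + 1)} : (Gp n0 G).Adj (.L u i) .W ↔ (i : ℕ) = 0 := by
  rw [SimpleGraph.adj_comm, adj_W_L]

theorem adj_R_W {u : V} {i : Fin (10 * n0)} : ¬ (Gp n0 G).Adj (.R u i) .W := by
  rw [SimpleGraph.adj_comm]
  exact adj_W_R

variable [Fintype V]

variable (G) in
theorem bondSum_Gp (hn0 : 0 < n0) (c : GPV V n0 → ℤˣ) :
    bondSum (Gp n0 G) c =
      2 * ((∑ i, (c (.X i) : ℤ)) * (∑ i, (c (.Y i) : ℤ))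
        + ∑ u, (∑ i, (c (.L u i) : ℤ)) * (∑ i, (c (.R u i) : ℤ))
        + ((c (xzero V n0 hn0) : ℤ) + (c (yzero V n0 hn0) : ℤ)) *
          ((∑ u, ∑ i, (c (.L u i) : ℤ)) + (∑ u, ∑ i, (c (.R u i) : ℤ)) + (c .W : ℤ))
        + (c .W : ℤ) * ∑ u, (c (.L u 0) : ℤ))
      + ∑ u, ∑ v, if G.Adj u v then ∑ i, (c (.L u i) : ℤ) * (c (.L v i) : ℤ) else 0 := by
  have hN : 0 < 100 * n0 * n0 := Nat.mul_pos (Nat.mul_pos (by norm_num) hn0) hn0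
  have hfield : ∀ a, (∑ b, if (Gp n0 G).Adj a b then (c a : ℤ) * (c b : ℤ) else 0) =
      c a * ∑ b, if (Gp n0 G).Adj a b then (c b : ℤ) else 0 := by
    intro a
    simp [Finset.mul_sum]
  have hL : ∀ u i, (∑ b, if (Gp n0 G).Adj (.L u i) b then (c b : ℤ) else 0) =
      (∑ v, if G.Adj u v then (c (.L v i) : ℤ) else 0) + ((∑ j, (c (.R u j) : ℤ)) +
      (c (xzero V n0 hn0) + (c (yzero V n0 hn0) + if (i : ℕ) = 0 then (c .W : ℤ) else 0))) := by
    intro u i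
    rw [sum_GPV]
    simp only [adj_L_L, adj_L_R, adj_L_X, adj_L_Y, adj_L_W, sum_ite_val_eq_zero hN]
    congr 1
    · refine Finset.sum_congr rfl fun v _ => ?_
      by_cases h : G.Adj u v <;> simp [h]
    · congr 1
      rw [Finset.sum_comm]
      simp
  have hR : ∀ u i, (∑ b, if (Gp n0 G).Adj (.R u i) b then (c b : ℤ) else 0) =
      (∑ j, (c (.L u j) : ℤ)) + (c (xzero V n0 hn0) + c (yzero V n0 hn0)) := by
    intro u i
    rw [sum_GPV]
    simp only [adj_R_L, adj_R_R, adj_R_X, adj_R_Y, adj_R_W, sum_ite_val_eq_zero hN]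
    rw [Finset.sum_comm]
    simp [xzero, yzero]
  have hX : ∀ i, (∑ b, if (Gp n0 G).Adj (.X i) b then (c b : ℤ) else 0) =
      (∑ j, (c (.Y j) : ℤ)) + if (i : ℕ) = 0 then ((∑ u, ∑ i, (c (.L u i) : ℤ)) +
        (∑ u, ∑ i, (c (.R u i) : ℤ)) + (c .W : ℤ)) else 0 := by
    intro i
    rw [sum_GPV]
    simp only [adj_X_L, adj_X_R, adj_X_X, adj_X_Y, adj_X_W]
    by_cases h : (i : ℕ) = 0
    · simp only [h, if_true, if_false, Finset.sum_const_zero]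
      ring
    · simp [h]
  have hY : ∀ i, (∑ b, if (Gp n0 G).Adj (.Y i) b then (c b : ℤ) else 0) =
      (∑ j, (c (.X j) : ℤ)) + if (i : ℕ) = 0 then ((∑ u, ∑ i, (c (.L u i) : ℤ)) +
        (∑ u, ∑ i, (c (.R u i) : ℤ)) + (c .W : ℤ)) else 0 := by
    intro i
    rw [sum_GPV]
    simp only [adj_Y_L, adj_Y_R, adj_Y_X, adj_Y_Y, adj_Y_W]
    by_cases h : (i : ℕ) = 0
    · simp only [h, if_true, if_false, Finset.sum_const_zero]
      ring
    · simp [h]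
  have hW : (∑ b, if (Gp n0 G).Adj .W b then (c b : ℤ) else 0) =
      (∑ u, (c (.L u 0) : ℤ)) + (c (xzero V n0 hn0) + c (yzero V n0 hn0)) := by
    rw [sum_GPV]
    simp only [adj_W_L, adj_W_R, adj_W_X, adj_W_Y, adj_W_W, sum_ite_val_eq_zero hN,
      sum_ite_val_eq_zero n0.succ_pos]
    simp [xzero, yzero]
  have hLL : (∑ u, ∑ i, (c (.L u i) : ℤ) * ∑ v, if G.Adj u v then (c (.L v i) : ℤ) else 0) =
      ∑ u, ∑ v, if G.Adj u v then ∑ i, (c (.L u i) : ℤ) * (c (.L v i) : ℤ) else 0 := by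
    refine Finset.sum_congr rfl fun u _ => ?_
    simp only [Finset.mul_sum]
    rw [Finset.sum_comm]
    refine Finset.sum_congr rfl fun v _ => ?_
    by_cases h : G.Adj u v <;> simp [h]
  have hLW : ∀ u, (∑ i : Fin (n0 + 1), (c (.L u i) : ℤ) * if (i : ℕ) = 0 then (c .W : ℤ) else 0) =
      c (.L u 0) * c .W := by
    intro u
    simp only [mul_ite, mul_zero]
    rw [sum_ite_val_eq_zero n0.succ_pos]
    rfl
  have hXS : ∀ t : ℤ, (∑ i : Fin (100 * n0 * n0), (c (.X i) : ℤ) * if (i : ℕ) = 0 then t else 0) =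
      c (xzero V n0 hn0) * t := by
    intro t
    simp only [mul_ite, mul_zero]
    rw [sum_ite_val_eq_zero hN]
    rfl
  have hYS : ∀ t : ℤ, (∑ i : Fin (100 * n0 * n0), (c (.Y i) : ℤ) * if (i : ℕ) = 0 then t else 0) =
      c (yzero V n0 hn0) * t := by
    intro t
    simp only [mul_ite, mul_zero]
    rw [sum_ite_val_eq_zero hN]
    rfl
  rw [bondSum]
  simp only [hfield]
  rw [sum_GPV]
  simp only [hL, hR, hX, hY, hW, mul_add, Finset.sum_add_distrib, hLL, hLW, hXS, hYS,
    ← Finset.sum_mul]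
  have hcomm : (∑ u, (∑ i, (c (.R u i) : ℤ)) * ∑ i, (c (.L u i) : ℤ)) =
      ∑ u, (∑ i, (c (.L u i) : ℤ)) * ∑ i, (c (.R u i) : ℤ) :=
    Finset.sum_congr rfl fun u _ => mul_comm _ _
  rw [hcomm]
  ring

end Gadget

section MaxCut

theorem abs_sum_units_le {ι : Type*} [Fintype ι] (c : ι → ℤˣ) :
    |∑ i, (c i : ℤ)| ≤ Fintype.card ι := by
  have h : ∀ i, |(c i : ℤ)| = 1 := fun i => by
    rcases Int.units_eq_one_or (c i) with h | h <;> simp [h]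
  refine (Finset.abs_sum_le_sum_abs _ _).trans ?_
  simp [h]

theorem eq_of_sum_units_eq {ι : Type*} [Fintype ι] {c : ι → ℤˣ} {s : ℤˣ}
    (h : (s : ℤ) * ∑ i, (c i : ℤ) = Fintype.card ι) (i : ι) : c i = s := by
  have h1 : ∑ i, (1 - (s : ℤ) * (c i : ℤ)) = 0 := by
    rw [Finset.sum_sub_distrib, ← Finset.mul_sum, h]
    simp
  rw [Finset.sum_eq_zero_iff_of_nonneg fun i _ => one_sub_units_mul_nonneg s (c i)] at h1
  have h2 := h1 i (Finset.mem_univ i)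
  rcases Int.units_eq_one_or s with e1 | e1 <;> rcases Int.units_eq_one_or (c i) with e2 | e2 <;>
    simp_all

theorem extreme_of_mul_lt {N A B : ℤ} (hA : |A| ≤ N) (hB : |B| ≤ N) (h : A * B + N ^ 2 < N) :
    (A = N ∧ B = -N) ∨ (A = -N ∧ B = N) := by
  rw [abs_le] at hA hB
  have hA' : A = N ∨ A = -N := by
    by_contra hcon
    push Not at hcon
    have h1 : A ≤ N - 1 := by have := lt_of_le_of_ne hA.2 hcon.1; omega
    have h2 : -N + 1 ≤ A := by have := lt_of_le_of_ne hA.1 hcon.2.symm; omega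
    rcases le_total 0 B with hb | hb <;> nlinarith
  rcases hA' with rfl | rfl
  · left
    refine ⟨rfl, ?_⟩
    by_contra hcon
    have := lt_of_le_of_ne hB.1 (Ne.symm hcon)
    nlinarith
  · right
    refine ⟨rfl, ?_⟩
    by_contra hcon
    have := lt_of_le_of_ne hB.2 hcon
    nlinarith

theorem sum_sum_symm_split {V : Type*} [Fintype V] [DecidableEq V] (f : V → V → ℤ)
    (hf : ∀ u v, f u v = f v u) (a : V) (ha : f a a = 0) :
    ∑ u, ∑ v, f u v = (∑ u ∈ Finset.univ.erase a, ∑ v ∈ Finset.univ.erase a, f u v)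
      + 2 * ∑ v ∈ Finset.univ.erase a, f a v := by
  have h : ∀ u, ∑ v, f u v = f a u + ∑ v ∈ Finset.univ.erase a, f u v := fun u => by
    rw [hf a u, Finset.add_sum_erase _ _ (Finset.mem_univ a)]
  rw [← Finset.add_sum_erase _ _ (Finset.mem_univ a), h a, ha]
  rw [Finset.sum_congr rfl fun u _ => h u, Finset.sum_add_distrib]
  ring

variable {V : Type} [DecidableEq V] {n0 : ℕ} (G : SimpleGraph V) [DecidableRel G.Adj]

/-- The sign flip of the two frame anchors `x₀` and `y₀`. -/
def anchorFlip (V : Type) [DecidableEq V] (n0 : ℕ) (hn0 : 0 < n0) : GPV V n0 → ℤˣ :=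
  fun x => if x = xzero V n0 hn0 ∨ x = yzero V n0 hn0 then -1 else 1

theorem eq_anchor_of_forall_adj (hn0 : 0 < n0) {v : GPV V n0 → ℤˣ}
    (h : ∀ a b, (Gp n0 G).Adj a b → anchorFlip V n0 hn0 a ≠ anchorFlip V n0 hn0 b → v a = v b)
    (u : V) (x : GPV V n0) : v x = v (xzero V n0 hn0) := by
  have hx : ∀ a, (Gp n0 G).Adj (xzero V n0 hn0) a → anchorFlip V n0 hn0 a = 1 →
      v a = v (xzero V n0 hn0) := fun a hadj ha =>
    (h _ _ hadj (by rw [ha]; simp [anchorFlip])).symm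
  have hy : ∀ a, (Gp n0 G).Adj (yzero V n0 hn0) a → anchorFlip V n0 hn0 a = 1 →
      v a = v (yzero V n0 hn0) := fun a hadj ha =>
    (h _ _ hadj (by rw [ha]; simp [anchorFlip])).symm
  have hL : ∀ w i, v (.L w i) = v (xzero V n0 hn0) := fun w i =>
    hx _ (adj_X_L.2 rfl) (by simp [anchorFlip, xzero, yzero])
  have hxy : v (yzero V n0 hn0) = v (xzero V n0 hn0) := by
    rw [← hL u 0]
    exact (hy _ (adj_Y_L.2 rfl) (by simp [anchorFlip, xzero, yzero])).symm
  cases x with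
  | L w i => exact hL w i
  | R w i => exact hx _ (adj_X_R.2 rfl) (by simp [anchorFlip, xzero, yzero])
  | W => exact hx _ (adj_X_W.2 rfl) (by simp [anchorFlip, xzero, yzero])
  | X i =>
    by_cases hi : GPV.X i = xzero V n0 hn0
    · rw [hi]
    · rw [← hxy]
      exact hy _ adj_Y_X (by rw [anchorFlip, if_neg]; simp [hi, yzero])
  | Y i =>
    by_cases hi : GPV.Y i = yzero V n0 hn0
    · rw [hi, hxy]
    · exact hx _ adj_X_Y (by rw [anchorFlip, if_neg]; simp [hi, xzero])

variable [Fintype V]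

theorem bondSum_le_of_eq_maxCut {W : Type} [Fintype W] [DecidableEq W] {H : SimpleGraph W}
    [DecidableRel H.Adj] {c : W → ℤˣ} (hc : spinCut H c = maxCut H) (c' : W → ℤˣ) :
    bondSum H c ≤ bondSum H c' := by
  have h1 := spinCut_le_maxCut H c'
  have h2 := four_mul_spinCut_eq_sub H c
  have h3 := four_mul_spinCut_eq_sub H c'
  omega

theorem spinCut_anchorFlip (hn0 : 0 < n0) (hV : Fintype.card V = n0) :
    (spinCut (Gp n0 G) (anchorFlip V n0 hn0) : ℤ) =
      200 * (n0 : ℤ) ^ 2 + 2 * (n0 : ℤ) * (11 * (n0 : ℤ) + 1) := by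
  have hN : 0 < 100 * n0 * n0 := Nat.mul_pos (Nat.mul_pos (by norm_num) hn0) hn0
  have hX : ∑ i : Fin (100 * n0 * n0), ((if i = ⟨0, hN⟩ then -1 else 1 : ℤˣ) : ℤ) =
      100 * n0 * n0 - 2 := by
    have h : ∀ i : Fin (100 * n0 * n0), ((if i = ⟨0, hN⟩ then -1 else 1 : ℤˣ) : ℤ) =
      1 - if i = ⟨0, hN⟩ then 2 else 0 := fun i => by split_ifs <;> simp
    simp only [h]
    rw [Finset.sum_sub_distrib]
    simp
  have h := four_mul_spinCut_eq_sub (Gp n0 G) (anchorFlip V n0 hn0)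
  rw [bondSum_Gp G hn0, bondSum_Gp G hn0] at h
  simp only [anchorFlip, xzero, yzero, GPV.X.injEq, GPV.Y.injEq, reduceCtorEq, or_false, false_or,
    hX, if_false, if_true, Pi.one_apply, Units.val_one, Finset.sum_const, Finset.card_univ,
    Fintype.card_fin, hV, Units.val_neg, nsmul_eq_mul] at h
  push_cast at h
  linarith

theorem frame_of_maxCut (hn0 : 0 < n0) (hV : Fintype.card V = n0) {c : GPV V n0 → ℤˣ}
    (hc : spinCut (Gp n0 G) c = maxCut (Gp n0 G)) :
    ∃ a : ℤˣ, (∀ i, c (.X i) = a) ∧ ∀ i, c (.Y i) = -a := by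
  let c' : GPV V n0 → ℤˣ := fun x => match x with
    | .X _ => 1
    | .Y _ => -1
    | y => c y
  have h := bondSum_le_of_eq_maxCut hc c'
  rw [bondSum_Gp G hn0, bondSum_Gp G hn0] at h
  have hA := abs_sum_units_le fun i => c (.X i)
  have hB := abs_sum_units_le fun i => c (.Y i)
  have hL := abs_sum_units_le fun q : V × Fin (n0 + 1) => c (.L q.1 q.2)
  have hR := abs_sum_units_le fun q : V × Fin (10 * n0) => c (.R q.1 q.2)
  rw [Fintype.sum_prod_type] at hL hR
  simp only [Fintype.card_fin, Fintype.card_prod, hV] at hA hB hL hR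
  simp only [c', xzero, yzero, Units.val_one, Units.val_neg, Finset.sum_const, Finset.card_univ,
    Fintype.card_fin, nsmul_eq_mul] at h
  set A := ∑ i, (c (.X i) : ℤ)
  set B := ∑ i, (c (.Y i) : ℤ)
  set L := ∑ u, ∑ i, (c (.L u i) : ℤ)
  set R := ∑ u, ∑ i, (c (.R u i) : ℤ)
  push_cast at h hA hB hL hR
  have hlt : A * B + (100 * n0 * n0 : ℤ) ^ 2 < 100 * n0 * n0 := by
    rw [abs_le] at hL hR
    have h1 : (1 : ℤ) ≤ n0 := by exact_mod_cast hn0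
    rcases Int.units_eq_one_or (c (.X ⟨0, _⟩)) with e1 | e1 <;>
      rcases Int.units_eq_one_or (c (.Y ⟨0, _⟩)) with e2 | e2 <;>
      rcases Int.units_eq_one_or (c .W) with e3 | e3 <;>
      rw [e1, e2, e3] at h <;> push_cast at h <;> nlinarith
  rcases extreme_of_mul_lt hA hB hlt with ⟨h1, h2⟩ | ⟨h1, h2⟩
  · refine ⟨1, eq_of_sum_units_eq (c := fun i => c (.X i)) ?_,
      eq_of_sum_units_eq (c := fun i => c (.Y i)) ?_⟩
    · change _ * A = _
      simp [h1]
    · change _ * B = _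
      simp [h2]
  · refine ⟨-1, eq_of_sum_units_eq (c := fun i => c (.X i)) ?_,
      eq_of_sum_units_eq (c := fun i => c (.Y i)) ?_⟩
    · change _ * A = _
      simp [h1]
    · change _ * B = _
      simp [h2]

theorem sub_mul_units_ge (s t r : ℤˣ) : -(1 - (s : ℤ) * t) ≤ ((t : ℤ) - s) * r := by
  rcases Int.units_eq_one_or s with h | h <;> rcases Int.units_eq_one_or t with h' | h' <;>
    rcases Int.units_eq_one_or r with h'' | h'' <;> simp [h, h', h'']

theorem exists_units_mul_nonneg (a : ℤ) : ∃ s : ℤˣ, 0 ≤ (s : ℤ) * a := by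
  rcases le_total 0 a with h | h
  · exact ⟨1, by simpa using h⟩
  · exact ⟨-1, by simpa using h⟩

theorem sync_sum_sub_ge (hV : Fintype.card V = n0) (ℓ : V → Fin (n0 + 1) → ℤˣ) (u : V) (s : ℤˣ) :
    -(2 * ((n0 : ℤ) - 1) * ∑ i, (1 - (s : ℤ) * (ℓ u i : ℤ))) ≤
      (∑ a, ∑ b, if G.Adj a b then ∑ i, (ℓ a i : ℤ) * (ℓ b i : ℤ) else 0)
      - ∑ a, ∑ b, if G.Adj a b then
        ∑ i, ((if a = u then s else ℓ a i : ℤˣ) : ℤ) * ((if b = u then s else ℓ b i : ℤˣ) : ℤ)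
        else 0 := by
  rw [sum_sum_symm_split _ (fun a b => by simp only [G.adj_comm a b, mul_comm]) u (by simp),
    sum_sum_symm_split _ (fun a b => by simp only [G.adj_comm a b, mul_comm]) u (by simp)]
  have h1 : ∑ a ∈ Finset.univ.erase u, ∑ b ∈ Finset.univ.erase u, (if G.Adj a b then
        ∑ i, ((if a = u then s else ℓ a i : ℤˣ) : ℤ) * ((if b = u then s else ℓ b i : ℤˣ) : ℤ)
        else 0) = ∑ a ∈ Finset.univ.erase u, ∑ b ∈ Finset.univ.erase u, (if G.Adj a b then
        ∑ i, (ℓ a i : ℤ) * (ℓ b i : ℤ) else 0) := by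
    refine Finset.sum_congr rfl fun a ha => Finset.sum_congr rfl fun b hb => ?_
    simp [Finset.ne_of_mem_erase ha, Finset.ne_of_mem_erase hb]
  rw [h1, add_sub_add_left_eq_sub, ← mul_sub, ← Finset.sum_sub_distrib]
  have h2 : ∑ b ∈ Finset.univ.erase u, -(∑ i, (1 - (s : ℤ) * (ℓ u i : ℤ))) ≤
      ∑ b ∈ Finset.univ.erase u, ((if G.Adj u b then ∑ i, (ℓ u i : ℤ) * (ℓ b i : ℤ) else 0)
        - if G.Adj u b then
        ∑ i, ((if u = u then s else ℓ u i : ℤˣ) : ℤ) * ((if b = u then s else ℓ b i : ℤˣ) : ℤ)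
        else 0) := by
    refine Finset.sum_le_sum fun b hb => ?_
    have hb' := Finset.ne_of_mem_erase hb
    by_cases hadj : G.Adj u b
    · simp only [hadj, if_true, hb', if_false]
      rw [← Finset.sum_sub_distrib, ← Finset.sum_neg_distrib]
      refine Finset.sum_le_sum fun i _ => ?_
      rw [← sub_mul]
      exact sub_mul_units_ge _ _ _
    · simp only [hadj, if_false, sub_zero, Left.neg_nonpos_iff]
      exact Finset.sum_nonneg fun i _ => one_sub_units_mul_nonneg _ _
  rw [Finset.sum_const, Finset.card_erase_of_mem (Finset.mem_univ u), Finset.card_univ, hV,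
    nsmul_eq_mul, Nat.cast_sub (hV ▸ Fintype.card_pos_iff.2 ⟨u⟩)] at h2
  push_cast at h2
  linarith

theorem extreme_of_mul_add_le {n l r : ℤ} (hn : 1 ≤ n) (h0 : 0 ≤ l) (hl : l ≤ n + 1)
    (hr : -(10 * n) ≤ r) (key : l * r + 10 * n * (n + 1) ≤ n * (n + 1 - l)) :
    l = n + 1 ∧ r = -(10 * n) := by
  have h1 : 0 ≤ l * (r + 10 * n) := mul_nonneg h0 (by linarith)
  have h2 : l = n + 1 := by
    by_contra hne
    have : 0 < n * (n + 1 - l) := mul_pos (by linarith) (by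
      have := lt_of_le_of_ne hl hne
      linarith)
    linarith
  refine ⟨h2, ?_⟩
  subst h2
  by_contra hne
  have : 0 < (n + 1) * (r + 10 * n) := mul_pos (by linarith) (by
    have := lt_of_le_of_ne hr (Ne.symm hne)
    linarith)
  linarith

theorem gadget_of_maxCut (hn0 : 0 < n0) (hV : Fintype.card V = n0) {c : GPV V n0 → ℤˣ}
    (hc : spinCut (Gp n0 G) c = maxCut (Gp n0 G)) (u : V) :
    ∃ s : ℤˣ, (∀ i, c (.L u i) = s) ∧ ∀ i, c (.R u i) = -s := by
  obtain ⟨a, hX, hY⟩ := frame_of_maxCut G hn0 hV hc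
  obtain ⟨s, hs⟩ := exists_units_mul_nonneg (∑ i, (c (.L u i) : ℤ))
  let c' : GPV V n0 → ℤˣ := fun x => match x with
    | .L v i => if v = u then s else c (.L v i)
    | .R v i => if v = u then -s else c (.R v i)
    | y => c y
  have h := bondSum_le_of_eq_maxCut hc c'
  have hF := sync_sum_sub_ge G hV (fun v i => c (.L v i)) u s
  rw [bondSum_Gp G hn0, bondSum_Gp G hn0] at h
  have hLR : ∑ v, (∑ i, (c' (.L v i) : ℤ)) * (∑ i, (c' (.R v i) : ℤ)) =
      (∑ v, (∑ i, (c (.L v i) : ℤ)) * (∑ i, (c (.R v i) : ℤ)))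
      - (∑ i, (c (.L u i) : ℤ)) * (∑ i, (c (.R u i) : ℤ)) - (n0 + 1) * (10 * n0) := by
    rw [← Finset.add_sum_erase _ _ (Finset.mem_univ u), ← Finset.add_sum_erase Finset.univ
      (fun v => (∑ i, (c (.L v i) : ℤ)) * (∑ i, (c (.R v i) : ℤ))) (Finset.mem_univ u)]
    have : ∑ v ∈ Finset.univ.erase u, (∑ i, (c' (.L v i) : ℤ)) * (∑ i, (c' (.R v i) : ℤ)) =
        ∑ v ∈ Finset.univ.erase u, (∑ i, (c (.L v i) : ℤ)) * (∑ i, (c (.R v i) : ℤ)) := by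
      refine Finset.sum_congr rfl fun v hv => ?_
      simp [c', Finset.ne_of_mem_erase hv]
    rw [this]
    have hss := units_sq s
    simp only [c', if_true, Finset.sum_const, Finset.card_univ, Fintype.card_fin, nsmul_eq_mul]
    push_cast
    linear_combination (-(n0 + 1) * (10 * n0) : ℤ) * hss
  have hW : ∑ v, (c' (.L v 0) : ℤ) = (∑ v, (c (.L v 0) : ℤ)) - c (.L u 0) + s := by
    rw [← Finset.add_sum_erase _ _ (Finset.mem_univ u), ← Finset.add_sum_erase Finset.univ
      (fun v => (c (.L v 0) : ℤ)) (Finset.mem_univ u)]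
    have : ∑ v ∈ Finset.univ.erase u, (c' (.L v 0) : ℤ) =
        ∑ v ∈ Finset.univ.erase u, (c (.L v 0) : ℤ) := by
      refine Finset.sum_congr rfl fun v hv => ?_
      simp [c', Finset.ne_of_mem_erase hv]
    rw [this]
    simp only [c', if_true]
    ring
  have hctrl : -(∑ i, (1 - (s : ℤ) * (c (.L u i) : ℤ))) ≤
      ((c (.L u 0) : ℤ) - s) * c .W := by
    refine le_trans ?_ (sub_mul_units_ge _ _ _)
    exact neg_le_neg (Finset.single_le_sum (f := fun i => 1 - (s : ℤ) * (c (.L u i) : ℤ))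
      (fun i _ => one_sub_units_mul_nonneg _ _) (Finset.mem_univ 0))
  have hx : (c (xzero V n0 hn0) : ℤ) = a := congrArg _ (hX _)
  have hy : (c (yzero V n0 hn0) : ℤ) = -a := by rw [yzero, hY]; simp
  have hx' : (c' (xzero V n0 hn0) : ℤ) = a := hx
  have hy' : (c' (yzero V n0 hn0) : ℤ) = -a := hy
  rw [hLR, hW, hx, hy, hx', hy'] at h
  have hB := abs_sum_units_le fun i => c (.R u i)
  have hA := abs_sum_units_le fun i => c (.L u i)
  rw [Finset.sum_sub_distrib, ← Finset.mul_sum] at hF hctrl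
  simp only [c', Finset.sum_const, Finset.card_univ, Fintype.card_fin, nsmul_eq_mul] at h hF hctrl hA hB
  have hss := units_sq s
  have hLReq : (∑ i, (c (.L u i) : ℤ)) * (∑ i, (c (.R u i) : ℤ)) =
      ((s : ℤ) * ∑ i, (c (.L u i) : ℤ)) * ((s : ℤ) * ∑ i, (c (.R u i) : ℤ)) := by
    linear_combination (-(∑ i, (c (.L u i) : ℤ)) * (∑ i, (c (.R u i) : ℤ))) * hss
  have hsabs : |(s : ℤ)| = 1 := by rcases Int.units_eq_one_or s with h | h <;> simp [h]
  have hA' : |(s : ℤ) * ∑ i, (c (.L u i) : ℤ)| ≤ n0 + 1 := by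
    rw [abs_mul, hsabs, one_mul]; exact_mod_cast hA
  have hB' : |(s : ℤ) * ∑ i, (c (.R u i) : ℤ)| ≤ 10 * n0 := by
    rw [abs_mul, hsabs, one_mul]; exact_mod_cast hB
  rw [hLReq] at h
  have hl : (s : ℤ) * ∑ i, (c (.L u i) : ℤ) = n0 + 1 ∧ (s : ℤ) * ∑ i, (c (.R u i) : ℤ) = -(10 * n0) := by
    set l := (s : ℤ) * ∑ i, (c (.L u i) : ℤ)
    set r := (s : ℤ) * ∑ i, (c (.R u i) : ℤ)
    rw [abs_le] at hA' hB'
    have h1 : (1 : ℤ) ≤ n0 := by exact_mod_cast hn0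
    push_cast at hF hctrl
    exact extreme_of_mul_add_le h1 hs hA'.2 hB'.1 (by linarith)
  refine ⟨s, eq_of_sum_units_eq (c := fun i => c (.L u i)) ?_,
    eq_of_sum_units_eq (c := fun i => c (.R u i)) ?_⟩
  · rw [hl.1]; simp
  · have := hl.2
    rw [Units.val_neg, neg_mul, this]; simp

/-- The sum of spins is, up to sign, the same for all maximum cuts of `G'`. -/
theorem exists_sum_eq_of_maxCut (hn0 : 0 < n0) (hV : Fintype.card V = n0) :
    ∃ τ : ℤ, ∀ c : GPV V n0 → ℤˣ, spinCut (Gp n0 G) c = maxCut (Gp n0 G) →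
      (c (xzero V n0 hn0) : ℤ) + c (yzero V n0 hn0) = 0 ∧
        (∑ x, (c x : ℤ) = τ ∨ ∑ x, (c x : ℤ) = -τ) := by
  have hstruct : ∀ c : GPV V n0 → ℤˣ, spinCut (Gp n0 G) c = maxCut (Gp n0 G) →
      (c (xzero V n0 hn0) : ℤ) + c (yzero V n0 hn0) = 0 ∧ ∃ σ : V → ℤˣ,
        ∑ x, (c x : ℤ) = (∑ u, (σ u : ℤ)) * (1 - 9 * n0) + c .W ∧
        bondSum (Gp n0 G) c = -2 * (100 * n0 * n0) ^ 2 - 2 * n0 * ((n0 + 1) * (10 * n0)) +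
          2 * (c .W * ∑ u, (σ u : ℤ)) + (n0 + 1) * bondSum G σ ∧
        (c .W : ℤ) * ∑ u, (σ u : ℤ) ≤ 0 := by
    intro c hc
    obtain ⟨a, hX, hY⟩ := frame_of_maxCut G hn0 hV hc
    choose σ hL hR using gadget_of_maxCut G hn0 hV hc
    have hx : (c (xzero V n0 hn0) : ℤ) = a := congrArg _ (hX _)
    have hy : (c (yzero V n0 hn0) : ℤ) = -a := by rw [yzero, hY]; simp
    have haa := units_sq a
    have hform : ∀ w : ℤˣ, bondSum (Gp n0 G) (fun x => if x = .W then w else c x) =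
        -2 * (100 * n0 * n0) ^ 2 - 2 * n0 * ((n0 + 1) * (10 * n0)) +
          2 * (w * ∑ u, (σ u : ℤ)) + (n0 + 1) * bondSum G σ := by
      intro w
      rw [bondSum_Gp G hn0, bondSum]
      simp only [reduceCtorEq, if_false, if_true, hX, hY, hL, hR, xzero, yzero, Finset.sum_const,
        Finset.card_univ, Fintype.card_fin, nsmul_eq_mul, Units.val_neg]
      have h1 : ∀ u, (((n0 + 1 : ℕ) : ℤ) * (σ u : ℤ)) * (((10 * n0 : ℕ) : ℤ) * -(σ u : ℤ)) =
          -((n0 + 1) * (10 * n0)) := fun u => by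
        have := units_sq (σ u)
        push_cast
        linear_combination (-(n0 + 1) * (10 * n0) : ℤ) * this
      have h2 : (∑ u, ∑ v, if G.Adj u v then ((n0 + 1 : ℕ) : ℤ) * ((σ u : ℤ) * (σ v : ℤ)) else 0) =
          (n0 + 1) * ∑ u, ∑ v, if G.Adj u v then (σ u : ℤ) * (σ v : ℤ) else 0 := by
        simp [Finset.mul_sum]
      simp only [h1, h2, Finset.sum_const, Finset.card_univ, hV, nsmul_eq_mul]
      push_cast
      linear_combination (-2 * (100 * n0 * n0) ^ 2 : ℤ) * haa
    have hcW : (fun x => if x = .W then c .W else c x) = c := by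
      ext x; by_cases h : x = .W <;> simp [h]
    have hbond := hform (c .W)
    rw [hcW] at hbond
    refine ⟨by rw [hx, hy]; ring, σ, ?_, hbond, ?_⟩
    · rw [sum_GPV]
      simp only [hX, hY, hL, hR, Finset.sum_const, Finset.card_univ, Fintype.card_fin,
        nsmul_eq_mul, Units.val_neg, ← Finset.mul_sum, Finset.sum_neg_distrib]
      push_cast
      ring
    · have h2 := bondSum_le_of_eq_maxCut hc (fun x => if x = .W then -c .W else c x)
      rw [hform, hbond] at h2
      push_cast at h2
      linarith
  obtain ⟨c0, hc0⟩ := exists_spinCut_eq_maxCut (Gp n0 G)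
  refine ⟨∑ x, (c0 x : ℤ), fun c hc => ⟨(hstruct c hc).1, ?_⟩⟩
  obtain ⟨-, σ, hsum, hbond, hle⟩ := hstruct c hc
  obtain ⟨-, σ0, hsum0, hbond0, hle0⟩ := hstruct c0 hc0
  have heq : bondSum (Gp n0 G) c = bondSum (Gp n0 G) c0 :=
    le_antisymm (bondSum_le_of_eq_maxCut hc _) (bondSum_le_of_eq_maxCut hc0 _)
  have hG := four_mul_spinCut_eq_sub G σ
  have hG0 := four_mul_spinCut_eq_sub G σ0
  have hge : ∀ (w : ℤˣ) (τ : V → ℤˣ), -(n0 : ℤ) ≤ (w : ℤ) * ∑ u, (τ u : ℤ) := by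
    intro w τ
    have h := abs_sum_units_le τ
    rw [hV, abs_le] at h
    rcases Int.units_eq_one_or w with e | e <;> simp [e] <;> linarith
  have h1 := hge (c .W) σ
  have h2 := hge (c0 .W) σ0
  rw [hbond, hbond0] at heq
  have hcut : (spinCut G σ : ℤ) = spinCut G σ0 := by
    have h3 : (c .W : ℤ) * ∑ u, (σ u : ℤ) - c0 .W * ∑ u, (σ0 u : ℤ) =
        2 * ((n0 + 1) * ((spinCut G σ : ℤ) - spinCut G σ0)) := by
      have e1 : bondSum G σ = bondSum G 1 - 4 * spinCut G σ := by linarith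
      have e2 : bondSum G σ0 = bondSum G 1 - 4 * spinCut G σ0 := by linarith
      rw [e1, e2] at heq
      linarith
    rcases lt_trichotomy (spinCut G σ : ℤ) (spinCut G σ0) with h | h | h
    · nlinarith
    · exact h
    · nlinarith
  have hWK : (c .W : ℤ) * ∑ u, (σ u : ℤ) = c0 .W * ∑ u, (σ0 u : ℤ) := by
    have : bondSum G σ = bondSum G σ0 := by linarith
    rw [this] at heq
    linarith
  rw [hsum, hsum0]
  rcases Int.units_eq_one_or (c .W) with e | e <;> rcases Int.units_eq_one_or (c0 .W) with e' | e' <;>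
    rw [e, e'] at hWK ⊢ <;> simp only [Units.val_one, Units.val_neg, one_mul, neg_mul] at hWK ⊢
  · left; rw [hWK]
  · right; rw [hWK]; ring
  · right; rw [← hWK]; ring
  · left; rw [neg_inj.1 hWK]

end MaxCut

section Kernel

theorem lay_val {p : ℕ} {j : ℤ} (h1 : -(p : ℤ) ≤ j) (h2 : j ≤ p) :
    ((lay p j : ℕ) : ℤ) = j + p := by
  have h : (j + p).toNat % (2 * p + 1) = (j + p).toNat := Nat.mod_eq_of_lt (by omega)
  simp only [lay, h]
  omega

theorem lay_ne_lay_zero {p : ℕ} {j : ℤ} (h1 : -(p : ℤ) ≤ j) (h2 : j ≤ p) (hj : j ≠ 0) :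
    lay p j ≠ lay p 0 := by
  intro h
  have e1 := lay_val h1 h2
  have e2 := lay_val (p := p) (j := 0) (by omega) (by omega)
  rw [h, e2] at e1
  omega

/-- The part of the one-site kernel that does not involve layer `0`. -/
def outerKernel (p : ℕ) (β : ℕ → ℝ) (zx : Fin (2 * p + 1) → ℤˣ) : ℂ :=
  (1 / 2 : ℂ)
    * (∏ ℓ ∈ Finset.Icc 1 (p - 1), mElem (β ℓ) (zx (lay p ℓ)) (zx (lay p (ℓ + 1))))
    * (∏ ℓ ∈ Finset.Icc 1 (p - 1),
        mElemBar (β ℓ) (zx (lay p (-(ℓ : ℤ) - 1))) (zx (lay p (-(ℓ : ℤ)))))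

/-- The two mixer factors around layer `0` at angle `π / 4`, in closed form. -/
def midKernel (a s b : ℤˣ) : ℂ :=
  if a = b then 1 / 2 else -(Complex.I / 2) * ((s : ℤ) : ℂ) * ((a : ℤ) : ℂ)

theorem half_sqrt_two_sq : ((Real.sqrt 2 / 2 : ℝ) : ℂ) * ((Real.sqrt 2 / 2 : ℝ) : ℂ) = 1 / 2 := by
  rw [← Complex.ofReal_mul]
  have h : Real.sqrt 2 / 2 * (Real.sqrt 2 / 2) = 1 / 2 := by
    have := Real.mul_self_sqrt (show (0 : ℝ) ≤ 2 by norm_num)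
    linarith
  rw [h]
  push_cast
  rfl

theorem mElem_mul_mElemBar (a s b : ℤˣ) :
    mElem (Real.pi / 4) a s * mElemBar (Real.pi / 4) s b = midKernel a s b := by
  have h := half_sqrt_two_sq
  simp only [mElem, mElemBar, midKernel, Real.cos_pi_div_four, Real.sin_pi_div_four]
  rcases Int.units_eq_one_or a with rfl | rfl <;> rcases Int.units_eq_one_or s with rfl | rfl <;>
    rcases Int.units_eq_one_or b with rfl | rfl <;>
    simp only [show (1 : ℤˣ) ≠ -1 by decide, show (-1 : ℤˣ) ≠ 1 by decide, if_true, if_false,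
      Units.val_one, Units.val_neg, Int.cast_one, Int.cast_neg]
  · exact h
  · linear_combination (-Complex.I) * h
  · linear_combination h -
      (((Real.sqrt 2 / 2 : ℝ) : ℂ) * ((Real.sqrt 2 / 2 : ℝ) : ℂ)) * Complex.I_mul_I
  · linear_combination Complex.I * h
  · linear_combination Complex.I * h
  · linear_combination h -
      (((Real.sqrt 2 / 2 : ℝ) : ℂ) * ((Real.sqrt 2 / 2 : ℝ) : ℂ)) * Complex.I_mul_I
  · linear_combination (-Complex.I) * h
  · exact h

theorem kernel_eq {p : ℕ} (ψ : ℝ) (zx : Fin (2 * p + 1) → ℤˣ) :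
    kernel p (betaAngles p ψ) zx = outerKernel p (betaAngles p ψ) zx *
      midKernel (zx (lay p p)) (zx (lay p 0)) (zx (lay p (-(p : ℤ)))) := by
  rw [← mElem_mul_mElemBar, kernel, outerKernel]
  have h : betaAngles p ψ p = Real.pi / 4 := by simp [betaAngles]
  rw [h]
  ring

theorem outerKernel_congr {p : ℕ} (β : ℕ → ℝ) {zx zx' : Fin (2 * p + 1) → ℤˣ}
    (h : ∀ i, i ≠ lay p 0 → zx' i = zx i) : outerKernel p β zx' = outerKernel p β zx := by
  unfold outerKernel
  congr 1
  · congr 1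
    refine Finset.prod_congr rfl fun ℓ hℓ => ?_
    rw [Finset.mem_Icc] at hℓ
    rw [h _ (lay_ne_lay_zero (by omega) (by omega) (by omega)),
      h _ (lay_ne_lay_zero (by omega) (by omega) (by omega))]
  · refine Finset.prod_congr rfl fun ℓ hℓ => ?_
    rw [Finset.mem_Icc] at hℓ
    rw [h _ (lay_ne_lay_zero (by omega) (by omega) (by omega)),
      h _ (lay_ne_lay_zero (by omega) (by omega) (by omega))]

/-- Negate the spin of `x` on layer `0`. -/
def flipAt {W : Type} [DecidableEq W] {p : ℕ} (z : W → Fin (2 * p + 1) → ℤˣ) (x : W) :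
    W → Fin (2 * p + 1) → ℤˣ :=
  fun y i => if y = x ∧ i = lay p 0 then -z y i else z y i

variable {W : Type} [DecidableEq W]

theorem flipAt_flipAt {p : ℕ} (z : W → Fin (2 * p + 1) → ℤˣ) (x : W) :
    flipAt (flipAt z x) x = z := by
  ext y i
  by_cases h : y = x ∧ i = lay p 0 <;> simp [flipAt, h]

theorem flipAt_apply_of_ne {p : ℕ} (z : W → Fin (2 * p + 1) → ℤˣ) (x y : W)
    {i : Fin (2 * p + 1)} (hi : i ≠ lay p 0) : flipAt z x y i = z y i := by
  simp [flipAt, hi]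

theorem flipAt_ne {p : ℕ} (z : W → Fin (2 * p + 1) → ℤˣ) (x : W) : flipAt z x ≠ z := by
  intro h
  have h1 := congrFun (congrFun h x) (lay p 0)
  simp only [flipAt, and_self, if_true] at h1
  rcases Int.units_eq_one_or (z x (lay p 0)) with e | e <;> rw [e] at h1 <;> revert h1 <;> decide

/-- The outermost layers `p` and `-p` of `z` differ at `x` exactly when `x ∈ {a, b}`. -/
def MatchedAt {p : ℕ} (a b : W) (z : W → Fin (2 * p + 1) → ℤˣ) (x : W) : Prop :=
  z x (lay p p) = (if x = a ∨ x = b then -1 else 1) * z x (lay p (-(p : ℤ)))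

theorem matchedAt_congr {p : ℕ} (hp : p ≠ 0) (a b : W) {z z' : W → Fin (2 * p + 1) → ℤˣ}
    (h : ∀ x i, i ≠ lay p 0 → z' x i = z x i) (x : W) :
    MatchedAt a b z' x ↔ MatchedAt a b z x := by
  unfold MatchedAt
  rw [h x _ (lay_ne_lay_zero (by omega) (by omega) (by omega)),
    h x _ (lay_ne_lay_zero (by omega) (by omega) (by omega))]

variable [Fintype W]

theorem expnt_congr (H : SimpleGraph W) [DecidableRel H.Adj] {p : ℕ}
    {z z' : W → Fin (2 * p + 1) → ℤˣ}
    (h : ∀ x i, i ≠ lay p 0 → z' x i = z x i) : expnt H p z' = expnt H p z := by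
  unfold expnt
  refine Finset.sum_congr rfl fun j hj => ?_
  rw [Finset.mem_Icc] at hj
  simp only [layerCut_eq_spinCut]
  have h1 : ∀ x, z' x (lay p j) = z x (lay p j) := fun x =>
    h x _ (lay_ne_lay_zero (by omega) (by omega) (by omega))
  have h2 : ∀ x, z' x (lay p (-(j : ℤ))) = z x (lay p (-(j : ℤ))) := fun x =>
    h x _ (lay_ne_lay_zero (by omega) (by omega) (by omega))
  simp only [h1, h2]

theorem coeffTerm_flipAt {p : ℕ} (hp : p ≠ 0) (ψ : ℝ) {a b : W} (hab : a ≠ b)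
    {z : W → Fin (2 * p + 1) → ℤˣ} {x : W} (hx : ¬ MatchedAt a b z x) :
    coeffTerm p (betaAngles p ψ) a b (flipAt z x) = -coeffTerm p (betaAngles p ψ) a b z := by
  have hker : ∀ y, y ≠ x → flipAt z x y = z y := fun y hy => by
    ext i; simp [flipAt, hy]
  have hp1 : flipAt z x x (lay p p) = z x (lay p p) :=
    flipAt_apply_of_ne z x x (lay_ne_lay_zero (by omega) (by omega) (by omega))
  have hp2 : flipAt z x x (lay p (-(p : ℤ))) = z x (lay p (-(p : ℤ))) :=
    flipAt_apply_of_ne z x x (lay_ne_lay_zero (by omega) (by omega) (by omega))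
  have h0 : flipAt z x x (lay p 0) = -z x (lay p 0) := by simp [flipAt]
  have hkx : kernel p (betaAngles p ψ) (flipAt z x x) =
      (if x = a ∨ x = b then 1 else -1) * kernel p (betaAngles p ψ) (z x) := by
    rw [kernel_eq, kernel_eq, hp1, hp2, h0,
      outerKernel_congr _ (fun i hi => flipAt_apply_of_ne z x x hi)]
    unfold MatchedAt at hx
    unfold midKernel
    by_cases h : x = a ∨ x = b
    · rw [if_pos h] at hx
      have hx' : z x (lay p p) = z x (lay p (-(p : ℤ))) := by
        rcases Int.units_eq_one_or (z x (lay p p)) with e | e <;>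
          rcases Int.units_eq_one_or (z x (lay p (-(p : ℤ)))) with e' | e' <;> simp_all
      simp [h, hx']
    · rw [if_neg h, one_mul] at hx
      simp only [h, hx, if_false, Units.val_neg, Int.cast_neg]
      ring
  have hprod : ∏ y, kernel p (betaAngles p ψ) (flipAt z x y) =
      (if x = a ∨ x = b then 1 else -1) * ∏ y, kernel p (betaAngles p ψ) (z y) := by
    rw [← Finset.mul_prod_erase _ _ (Finset.mem_univ x),
      ← Finset.mul_prod_erase _ (fun y => kernel p (betaAngles p ψ) (z y)) (Finset.mem_univ x),
      hkx, mul_assoc]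
    congr 2
    exact Finset.prod_congr rfl fun y hy => by rw [hker y (Finset.ne_of_mem_erase hy)]
  unfold coeffTerm
  rw [hprod]
  by_cases ha : x = a
  · subst ha
    rw [h0, hker b hab.symm]
    simp
  · by_cases hb : x = b
    · subst hb
      rw [h0, hker a hab]
      simp
    · rw [hker a (Ne.symm ha), hker b (Ne.symm hb)]
      simp [ha, hb]

open Classical in
theorem sum_unmatched_eq_zero (H : SimpleGraph W) [DecidableRel H.Adj] {p : ℕ} (hp : p ≠ 0) (ψ : ℝ)
    {a b : W} (hab : a ≠ b) (k : ℤ) :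
    ∑ z ∈ Finset.univ.filter (fun z : W → Fin (2 * p + 1) → ℤˣ =>
        expnt H p z = k ∧ ¬ ∀ x, MatchedAt a b z x), coeffTerm p (betaAngles p ψ) a b z = 0 := by
  let pick : (W → Prop) → W := fun P => if h : ∃ x, ¬ P x then h.choose else a
  have hpick : ∀ P : W → Prop, (¬ ∀ x, P x) → ¬ P (pick P) := fun P hP => by
    have h : ∃ x, ¬ P x := not_forall.1 hP
    simp only [pick, dif_pos h]
    exact h.choose_spec
  have hne : ∀ (z : W → Fin (2 * p + 1) → ℤˣ) x y i, i ≠ lay p 0 → flipAt z x y i = z y i :=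
    fun z x y i hi => flipAt_apply_of_ne z x y hi
  have hsame : ∀ (z : W → Fin (2 * p + 1) → ℤˣ) x,
      MatchedAt a b (flipAt z x) = MatchedAt a b z := fun z x =>
    funext fun y => propext (matchedAt_congr hp a b (hne z x) y)
  refine Finset.sum_involution (fun z _ => flipAt z (pick (MatchedAt a b z))) ?_ ?_ ?_ ?_
  · intro z hz
    rw [Finset.mem_filter] at hz
    rw [coeffTerm_flipAt hp ψ hab (hpick _ hz.2.2), add_neg_cancel]
  · intro z _ _
    exact flipAt_ne _ _
  · intro z hz
    rw [Finset.mem_filter] at hz ⊢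
    rw [expnt_congr H (hne z _), hsame]
    exact ⟨Finset.mem_univ _, hz.2⟩
  · intro z _
    rw [hsame, flipAt_flipAt]

open Classical in
theorem sum_expnt_eq_sum_matched (H : SimpleGraph W) [DecidableRel H.Adj] {p : ℕ} (hp : p ≠ 0)
    (ψ : ℝ) {a b : W} (hab : a ≠ b) (k : ℤ) :
    ∑ z ∈ Finset.univ.filter (fun z : W → Fin (2 * p + 1) → ℤˣ => expnt H p z = k),
        coeffTerm p (betaAngles p ψ) a b z =
      ∑ z ∈ Finset.univ.filter (fun z : W → Fin (2 * p + 1) → ℤˣ =>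
        expnt H p z = k ∧ ∀ x, MatchedAt a b z x), coeffTerm p (betaAngles p ψ) a b z := by
  rw [← Finset.sum_filter_add_sum_filter_not _ (fun z => ∀ x, MatchedAt a b z x),
    Finset.filter_filter, Finset.filter_filter, sum_unmatched_eq_zero H hp ψ hab k, add_zero]

end Kernel

section Exponent

variable {W : Type} [Fintype W] [DecidableEq W]

theorem expnt_gap (H : SimpleGraph W) [DecidableRel H.Adj] {p : ℕ} (hp : 2 ≤ p)
    (χ : W → ℤˣ) (z : W → Fin (2 * p + 1) → ℤˣ) :
    ((p : ℤ) - 1) * maxCut H + spinCut H χ - expnt H p z =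
      ∑ j ∈ Finset.Icc 1 (p - 1), (((maxCut H : ℤ) - spinCut H (fun x => z x (lay p (j : ℤ)))) +
        spinCut H (fun x => z x (lay p (-(j : ℤ))))) +
      ((spinCut H χ : ℤ) + spinCut H (fun x => z x (lay p (-(p : ℤ)))) -
        spinCut H (fun x => z x (lay p p))) := by
  obtain ⟨q, rfl⟩ : ∃ q, p = q + 1 := ⟨p - 1, by omega⟩
  unfold expnt
  simp only [layerCut_eq_spinCut]
  rw [Finset.sum_Icc_succ_top (by omega)]
  simp only [Nat.add_sub_cancel, Finset.sum_add_distrib, Finset.sum_sub_distrib, Finset.sum_const,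
    Nat.card_Icc, nsmul_eq_mul]
  push_cast
  ring

theorem expnt_gap_nonneg (H : SimpleGraph W) [DecidableRel H.Adj] {p : ℕ}
    (z : W → Fin (2 * p + 1) → ℤˣ) (j : ℕ) :
    0 ≤ ((maxCut H : ℤ) - spinCut H (fun x => z x (lay p (j : ℤ)))) +
        spinCut H (fun x => z x (lay p (-(j : ℤ)))) := by
  have := spinCut_le_maxCut H (fun x => z x (lay p (j : ℤ)))
  omega

theorem expnt_top_gap_nonneg (H : SimpleGraph W) [DecidableRel H.Adj] {p : ℕ} {χ : W → ℤˣ}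
    {z : W → Fin (2 * p + 1) → ℤˣ}
    (hz : ∀ x, z x (lay p p) = χ x * z x (lay p (-(p : ℤ)))) :
    0 ≤ (spinCut H χ : ℤ) + spinCut H (fun x => z x (lay p (-(p : ℤ)))) -
        spinCut H (fun x => z x (lay p p)) := by
  have := spinCut_mul_le H χ (fun x => z x (lay p (-(p : ℤ))))
  simp only [hz]
  omega

theorem expnt_le_of_eq_mul (H : SimpleGraph W) [DecidableRel H.Adj] {p : ℕ} (hp : 2 ≤ p)
    {χ : W → ℤˣ} {z : W → Fin (2 * p + 1) → ℤˣ}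
    (hz : ∀ x, z x (lay p p) = χ x * z x (lay p (-(p : ℤ)))) :
    expnt H p z ≤ ((p : ℤ) - 1) * maxCut H + spinCut H χ := by
  have h1 := expnt_gap H hp χ z
  have h2 := Finset.sum_nonneg fun j (_ : j ∈ Finset.Icc 1 (p - 1)) => expnt_gap_nonneg H z j
  have h3 := expnt_top_gap_nonneg H hz
  linarith

theorem expnt_eq_iff_of_eq_mul (H : SimpleGraph W) [DecidableRel H.Adj] {p : ℕ} (hp : 2 ≤ p)
    {χ : W → ℤˣ} {z : W → Fin (2 * p + 1) → ℤˣ}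
    (hz : ∀ x, z x (lay p p) = χ x * z x (lay p (-(p : ℤ)))) :
    expnt H p z = ((p : ℤ) - 1) * maxCut H + spinCut H χ ↔
      (∀ j : ℕ, 1 ≤ j → j ≤ p - 1 → spinCut H (fun x => z x (lay p (j : ℤ))) = maxCut H ∧
        spinCut H (fun x => z x (lay p (-(j : ℤ)))) = 0) ∧
      spinCut H (fun x => z x (lay p p)) =
        spinCut H (fun x => z x (lay p (-(p : ℤ)))) + spinCut H χ := by
  have h1 := expnt_gap H hp χ z
  have h2 := Finset.sum_nonneg fun j (_ : j ∈ Finset.Icc 1 (p - 1)) => expnt_gap_nonneg H z j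
  have h3 := expnt_top_gap_nonneg H hz
  constructor
  · intro h
    have h4 := (Finset.sum_eq_zero_iff_of_nonneg fun j _ => expnt_gap_nonneg H z j).1
      (by linarith : ∑ j ∈ Finset.Icc 1 (p - 1), _ = (0 : ℤ))
    refine ⟨fun j hj hj' => ?_, by omega⟩
    have h5 := h4 j (Finset.mem_Icc.2 ⟨hj, hj'⟩)
    have := spinCut_le_maxCut H (fun x => z x (lay p (j : ℤ)))
    omega
  · rintro ⟨h, h'⟩
    have h4 : ∑ j ∈ Finset.Icc 1 (p - 1),
        (((maxCut H : ℤ) - spinCut H (fun x => z x (lay p (j : ℤ)))) +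
          spinCut H (fun x => z x (lay p (-(j : ℤ))))) = 0 :=
      Finset.sum_eq_zero fun j hj => by
        rw [Finset.mem_Icc] at hj
        rw [(h j hj.1 hj.2).1, (h j hj.1 hj.2).2]
        simp
    rw [h4] at h1
    omega

end Exponent

section TermValue

theorem mElem_mul_mElemBar_quarter (a b c d : ℤˣ) :
    mElem (Real.pi / 4) a b * mElemBar (Real.pi / 4) c d =
      1 / 2 * (Complex.exp (((-(Real.pi / 4) * ((a * b : ℤˣ) : ℤ) : ℝ) : ℂ) * Complex.I) *
        Complex.exp (((Real.pi / 4 * ((c * d : ℤˣ) : ℤ) : ℝ) : ℂ) * Complex.I)) := by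
  have h := half_sqrt_two_sq
  simp only [mElem, mElemBar, Real.cos_pi_div_four, Real.sin_pi_div_four, Complex.exp_mul_I]
  simp only [← Complex.ofReal_cos, ← Complex.ofReal_sin]
  rcases Int.units_eq_one_or a with rfl | rfl <;> rcases Int.units_eq_one_or b with rfl | rfl <;>
    rcases Int.units_eq_one_or c with rfl | rfl <;> rcases Int.units_eq_one_or d with rfl | rfl <;>
    simp only [show (1 : ℤˣ) ≠ -1 by decide, show (-1 : ℤˣ) ≠ 1 by decide, if_true, if_false,
      Units.val_one, Units.val_neg, Int.cast_one, Int.cast_neg, mul_one, mul_neg, neg_mul,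
      neg_neg, Real.cos_neg, Real.sin_neg, Real.cos_pi_div_four, Real.sin_pi_div_four,
      Complex.ofReal_neg] <;>
    generalize ((Real.sqrt 2 / 2 : ℝ) : ℂ) = r at * <;>
    have hI := Complex.I_mul_I <;> grind

end TermValue

section FrozenTerm

/-- The layered spins `zx` only change between layers `p - 1` and `-(p - 1)`, outside of
the four layers `±p` and `±(p - 1)`, by passing through layer `0`. -/
def Frozen {p : ℕ} (zx : Fin (2 * p + 1) → ℤˣ) : Prop :=
  ∀ ℓ : ℕ, 1 ≤ ℓ → ℓ < p - 1 → zx (lay p (ℓ : ℤ)) = zx (lay p ((ℓ : ℤ) + 1)) ∧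
    zx (lay p (-(ℓ : ℤ) - 1)) = zx (lay p (-(ℓ : ℤ)))

/-- A unit-modulus complex number `exp (i θ)`. -/
def phase (θ : ℝ) : ℂ := Complex.exp ((θ : ℂ) * Complex.I)

theorem phase_sum {ι : Type} (s : Finset ι) (θ : ι → ℝ) :
    ∏ i ∈ s, phase (θ i) = phase (∑ i ∈ s, θ i) := by
  simp only [phase]
  rw [← Complex.exp_sum, ← Finset.sum_mul, Complex.ofReal_sum]

theorem phase_re (θ : ℝ) : (phase θ).re = Real.cos θ := Complex.exp_ofReal_mul_I_re θ

theorem phase_add_phase_neg (θ : ℝ) : phase θ + phase (-θ) = ((2 * Real.cos θ : ℝ) : ℂ) := by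
  simp only [phase]
  push_cast
  rw [Complex.cos]
  ring

theorem betaAngles_of_lt {p ℓ : ℕ} (ψ : ℝ) (h : ℓ < p - 1) : betaAngles p ψ ℓ = ψ := by
  rw [betaAngles, if_neg (by omega)]

theorem betaAngles_sub_one (p : ℕ) (ψ : ℝ) : betaAngles p ψ (p - 1) = Real.pi / 4 := by
  simp [betaAngles]

theorem outerKernel_of_frozen {p : ℕ} (hp : 2 ≤ p) (ψ : ℝ) {zx : Fin (2 * p + 1) → ℤˣ}
    (h : Frozen zx) :
    outerKernel p (betaAngles p ψ) zx = (((1 / 4) * (Real.cos ψ) ^ (2 * (p - 2)) : ℝ) : ℂ) *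
      (phase (-(Real.pi / 4) * ((zx (lay p ((p : ℤ) - 1)) * zx (lay p p) : ℤˣ) : ℤ)) *
        phase (Real.pi / 4 *
          ((zx (lay p (-(p : ℤ))) * zx (lay p (-((p : ℤ) - 1))) : ℤˣ) : ℤ))) := by
  obtain ⟨q, rfl⟩ : ∃ q, p = q + 2 := ⟨p - 2, by omega⟩
  have h1 : ∏ ℓ ∈ Finset.Icc 1 q, mElem (betaAngles (q + 2) ψ ℓ) (zx (lay (q + 2) ℓ))
      (zx (lay (q + 2) (ℓ + 1))) = (Real.cos ψ : ℂ) ^ q := by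
    rw [Finset.prod_eq_pow_card (b := (Real.cos ψ : ℂ)), Nat.card_Icc, Nat.add_sub_cancel]
    intro ℓ hℓ
    rw [Finset.mem_Icc] at hℓ
    rw [betaAngles_of_lt ψ (by omega), (h ℓ hℓ.1 (by omega)).1, mElem, if_pos rfl]
  have h2 : ∏ ℓ ∈ Finset.Icc 1 q, mElemBar (betaAngles (q + 2) ψ ℓ)
      (zx (lay (q + 2) (-(ℓ : ℤ) - 1))) (zx (lay (q + 2) (-(ℓ : ℤ)))) = (Real.cos ψ : ℂ) ^ q := by
    rw [Finset.prod_eq_pow_card (b := (Real.cos ψ : ℂ)), Nat.card_Icc, Nat.add_sub_cancel]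
    intro ℓ hℓ
    rw [Finset.mem_Icc] at hℓ
    rw [betaAngles_of_lt ψ (by omega), (h ℓ hℓ.1 (by omega)).2, mElemBar, if_pos rfl]
  have hb : betaAngles (q + 2) ψ (q + 1) = Real.pi / 4 := betaAngles_sub_one (q + 2) ψ
  have e1 : ((q + 1 : ℕ) : ℤ) + 1 = ((q + 2 : ℕ) : ℤ) := by push_cast; ring
  have e2 : -((q + 1 : ℕ) : ℤ) - 1 = -((q + 2 : ℕ) : ℤ) := by push_cast; ring
  have e3 : ((q + 2 : ℕ) : ℤ) - 1 = ((q + 1 : ℕ) : ℤ) := by push_cast; ring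
  have hq := mElem_mul_mElemBar_quarter (zx (lay (q + 2) ((q + 1 : ℕ) : ℤ)))
    (zx (lay (q + 2) ((q + 2 : ℕ) : ℤ))) (zx (lay (q + 2) (-((q + 2 : ℕ) : ℤ))))
    (zx (lay (q + 2) (-((q + 1 : ℕ) : ℤ))))
  rw [outerKernel, show q + 2 - 1 = q + 1 by omega, Finset.prod_Icc_succ_top (by omega),
    Finset.prod_Icc_succ_top (by omega), h1, h2, hb, e1, e2, e3, show q + 2 - 2 = q by omega]
  simp only [phase]
  calc _ = 1 / 2 * ((Real.cos ψ : ℂ) ^ q * (Real.cos ψ : ℂ) ^ q) *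
        (mElem (Real.pi / 4) (zx (lay (q + 2) ((q + 1 : ℕ) : ℤ)))
          (zx (lay (q + 2) ((q + 2 : ℕ) : ℤ))) *
        mElemBar (Real.pi / 4) (zx (lay (q + 2) (-((q + 2 : ℕ) : ℤ))))
          (zx (lay (q + 2) (-((q + 1 : ℕ) : ℤ))))) := by ring
    _ = _ := by
      rw [hq]
      push_cast
      ring

variable {W : Type} [Fintype W] [DecidableEq W]

theorem prod_midKernel {p : ℕ} {a b : W} (hab : a ≠ b) {z : W → Fin (2 * p + 1) → ℤˣ}
    (hz : ∀ x, MatchedAt a b z x) :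
    ((z a (lay p 0) : ℤ) : ℂ) * ((z b (lay p 0) : ℤ) : ℂ) *
      ∏ x, midKernel (z x (lay p p)) (z x (lay p 0)) (z x (lay p (-(p : ℤ)))) =
    -((1 / 2) ^ Fintype.card W * (((z a (lay p p) * z b (lay p p) : ℤˣ) : ℤ) : ℂ)) := by
  have key : ∀ x, midKernel (z x (lay p p)) (z x (lay p 0)) (z x (lay p (-(p : ℤ)))) =
      1 / 2 * (if x = a ∨ x = b then
        -Complex.I * ((z x (lay p 0) : ℤ) : ℂ) * ((z x (lay p p) : ℤ) : ℂ) else 1) := fun x => by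
    have hx := hz x
    unfold MatchedAt at hx
    unfold midKernel
    by_cases h : x = a ∨ x = b
    · rw [if_pos h] at hx
      rw [if_pos h, if_neg]
      · ring
      · rw [hx]
        rcases Int.units_eq_one_or (z x (lay p (-(p : ℤ)))) with e | e <;> rw [e] <;> decide
    · rw [if_neg h, one_mul] at hx
      rw [if_neg h, if_pos hx, mul_one]
  rw [Finset.prod_congr rfl fun x _ => key x, Finset.prod_mul_distrib, Finset.prod_const,
    Finset.card_univ, Fintype.prod_eq_mul a b hab fun x hx => if_neg (by tauto),
    if_pos (Or.inl rfl), if_pos (Or.inr rfl)]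
  have hs : ∀ s : ℤˣ, ((s : ℤ) : ℂ) * ((s : ℤ) : ℂ) = 1 := fun s => by
    rcases Int.units_eq_one_or s with rfl | rfl <;> simp
  have ha := hs (z a (lay p 0))
  have hb := hs (z b (lay p 0))
  have hI := Complex.I_mul_I
  push_cast
  generalize ((z a (lay p 0) : ℤ) : ℂ) = u at *
  generalize ((z b (lay p 0) : ℤ) : ℂ) = v at *
  generalize ((z a (lay p p) : ℤ) : ℂ) = s at *
  generalize ((z b (lay p p) : ℤ) : ℂ) = t at *
  generalize (1 / 2 : ℂ) ^ Fintype.card W = r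
  calc _ = r * (u * u) * (v * v) * (Complex.I * Complex.I) * (s * t) := by ring
    _ = _ := by rw [ha, hb, hI]; ring

/-- The common modulus of the contributions of frozen configurations. -/
def frozenWeight (n p : ℕ) (ψ : ℝ) : ℝ := (1 / 8 * Real.cos ψ ^ (2 * (p - 2))) ^ n

theorem coeffTerm_of_frozen {p : ℕ} (hp : 2 ≤ p) (ψ : ℝ) {a b : W} (hab : a ≠ b)
    {z : W → Fin (2 * p + 1) → ℤˣ} (hz : ∀ x, MatchedAt a b z x) (hf : ∀ x, Frozen (z x))
    (hs : z a (lay p p) = z b (lay p p)) :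
    coeffTerm p (betaAngles p ψ) a b z = -(frozenWeight (Fintype.card W) p ψ : ℂ) *
      (phase (-(Real.pi / 4) *
          ((∑ x, ((z x (lay p ((p : ℤ) - 1)) * z x (lay p p) : ℤˣ) : ℤ) : ℤ) : ℝ)) *
        phase (Real.pi / 4 *
          ((∑ x, ((z x (lay p (-(p : ℤ))) * z x (lay p (-((p : ℤ) - 1))) : ℤˣ) : ℤ) : ℤ) : ℝ))) := by
  have hk : ∀ x, kernel p (betaAngles p ψ) (z x) = _ := fun x => kernel_eq ψ (z x)
  unfold coeffTerm
  simp only [hk, Finset.prod_mul_distrib]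
  rw [mul_left_comm, prod_midKernel hab hz, Finset.prod_congr rfl fun x _ =>
    outerKernel_of_frozen hp ψ (hf x), Finset.prod_mul_distrib, Finset.prod_mul_distrib,
    phase_sum, phase_sum, Finset.prod_const, Finset.card_univ, ← Finset.mul_sum, ← Finset.mul_sum,
    hs, frozenWeight]
  have h8 : (1 / 8 * (Real.cos ψ) ^ (2 * (p - 2)) : ℝ) =
    (1 / 4 * (Real.cos ψ) ^ (2 * (p - 2))) * (1 / 2) := by ring
  rw [h8, mul_pow, Int.units_mul_self]
  push_cast
  ring

end FrozenTerm

section NormBound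

theorem norm_prod_le_of_mem {ι : Type} [DecidableEq ι] {s : Finset ι} {f : ι → ℂ} {i : ι} {c : ℝ}
    (hi : i ∈ s) (hf : ∀ j ∈ s, ‖f j‖ ≤ 1) (hc : ‖f i‖ ≤ c) : ‖∏ j ∈ s, f j‖ ≤ c := by
  rw [← Finset.mul_prod_erase s f hi, norm_mul, norm_prod]
  have h1 : ∏ j ∈ s.erase i, ‖f j‖ ≤ 1 :=
    Finset.prod_le_one (fun _ _ => norm_nonneg _) fun j hj => hf j (Finset.mem_of_mem_erase hj)
  exact (mul_le_of_le_one_right (norm_nonneg _) h1).trans hc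

theorem norm_prod_le_one {ι : Type} {s : Finset ι} {f : ι → ℂ} (hf : ∀ j ∈ s, ‖f j‖ ≤ 1) :
    ‖∏ j ∈ s, f j‖ ≤ 1 := by
  rw [norm_prod]
  exact Finset.prod_le_one (fun _ _ => norm_nonneg _) hf

theorem norm_mElem_le_one (β : ℝ) (a b : ℤˣ) : ‖mElem β a b‖ ≤ 1 := by
  unfold mElem
  split_ifs
  · rw [Complex.norm_real]; exact Real.abs_cos_le_one β
  · rw [norm_mul, Complex.norm_I, one_mul, Complex.norm_real]; exact Real.abs_sin_le_one β

theorem norm_mElemBar_le_one (β : ℝ) (a b : ℤˣ) : ‖mElemBar β a b‖ ≤ 1 := by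
  unfold mElemBar
  split_ifs
  · rw [Complex.norm_real]; exact Real.abs_cos_le_one β
  · rw [norm_neg, norm_mul, Complex.norm_I, one_mul, Complex.norm_real]
    exact Real.abs_sin_le_one β

theorem norm_mElem_le_of_ne (β : ℝ) {a b : ℤˣ} (h : a ≠ b) : ‖mElem β a b‖ ≤ |β| := by
  rw [mElem, if_neg h, norm_mul, Complex.norm_I, one_mul, Complex.norm_real]
  exact Real.abs_sin_le_abs

theorem norm_mElemBar_le_of_ne (β : ℝ) {a b : ℤˣ} (h : a ≠ b) : ‖mElemBar β a b‖ ≤ |β| := by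
  rw [mElemBar, if_neg h, norm_neg, norm_mul, Complex.norm_I, one_mul, Complex.norm_real]
  exact Real.abs_sin_le_abs

theorem norm_mul_five_le {r A M N B : ℂ} {c : ℝ} (hr : ‖r‖ ≤ 1) (hA : ‖A‖ ≤ 1) (hM : ‖M‖ ≤ 1)
    (hN : ‖N‖ ≤ 1) (hB : ‖B‖ ≤ 1) (h : ‖A‖ ≤ c ∨ ‖B‖ ≤ c) : ‖r * A * M * N * B‖ ≤ c := by
  have hrMN : ‖r‖ * ‖M‖ * ‖N‖ ≤ 1 := mul_le_one₀ (mul_le_one₀ hr (norm_nonneg _) hM)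
    (norm_nonneg _) hN
  simp only [norm_mul]
  rcases h with h | h
  · calc ‖r‖ * ‖A‖ * ‖M‖ * ‖N‖ * ‖B‖ = ‖A‖ * (‖r‖ * ‖M‖ * ‖N‖ * ‖B‖) := by ring
      _ ≤ ‖A‖ := mul_le_of_le_one_right (norm_nonneg _) (mul_le_one₀ hrMN (norm_nonneg _) hB)
      _ ≤ c := h
  · calc ‖r‖ * ‖A‖ * ‖M‖ * ‖N‖ * ‖B‖ = ‖B‖ * (‖r‖ * ‖M‖ * ‖N‖ * ‖A‖) := by ring
      _ ≤ ‖B‖ := mul_le_of_le_one_right (norm_nonneg _) (mul_le_one₀ hrMN (norm_nonneg _) hA)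
      _ ≤ c := h

theorem norm_kernel_le {p : ℕ} (β : ℕ → ℝ) (zx : Fin (2 * p + 1) → ℤˣ) {c : ℝ}
    (h : ‖∏ ℓ ∈ Finset.Icc 1 (p - 1), mElem (β ℓ) (zx (lay p ℓ)) (zx (lay p (ℓ + 1)))‖ ≤ c ∨
      ‖∏ ℓ ∈ Finset.Icc 1 (p - 1),
        mElemBar (β ℓ) (zx (lay p (-(ℓ : ℤ) - 1))) (zx (lay p (-(ℓ : ℤ))))‖ ≤ c) :
    ‖kernel p β zx‖ ≤ c :=
  norm_mul_five_le (by norm_num) (norm_prod_le_one fun _ _ => norm_mElem_le_one _ _ _)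
    (norm_mElem_le_one _ _ _) (norm_mElemBar_le_one _ _ _)
    (norm_prod_le_one fun _ _ => norm_mElemBar_le_one _ _ _) h

theorem norm_kernel_le_one {p : ℕ} (β : ℕ → ℝ) (zx : Fin (2 * p + 1) → ℤˣ) :
    ‖kernel p β zx‖ ≤ 1 :=
  norm_kernel_le β zx (Or.inl (norm_prod_le_one fun _ _ => norm_mElem_le_one _ _ _))

theorem norm_kernel_le_of_not_frozen {p : ℕ} (ψ : ℝ) {zx : Fin (2 * p + 1) → ℤˣ}
    (h : ¬ Frozen zx) : ‖kernel p (betaAngles p ψ) zx‖ ≤ |ψ| := by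
  unfold Frozen at h
  push Not at h
  obtain ⟨ℓ, h1, h2, h3⟩ := h
  have hmem : ℓ ∈ Finset.Icc 1 (p - 1) := Finset.mem_Icc.2 ⟨h1, h2.le⟩
  refine norm_kernel_le _ _ ?_
  by_cases h4 : zx (lay p (ℓ : ℤ)) = zx (lay p ((ℓ : ℤ) + 1))
  · refine Or.inr (norm_prod_le_of_mem hmem (fun _ _ => norm_mElemBar_le_one _ _ _) ?_)
    rw [betaAngles_of_lt ψ h2]
    exact norm_mElemBar_le_of_ne ψ (h3 h4)
  · refine Or.inl (norm_prod_le_of_mem hmem (fun _ _ => norm_mElem_le_one _ _ _) ?_)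
    rw [betaAngles_of_lt ψ h2]
    exact norm_mElem_le_of_ne ψ h4

theorem norm_units_cast (s : ℤˣ) : ‖((s : ℤ) : ℂ)‖ = 1 := by
  rcases Int.units_eq_one_or s with rfl | rfl <;> simp

theorem norm_coeffTerm_le_of_not_frozen {W : Type} [Fintype W] [DecidableEq W] {p : ℕ} (ψ : ℝ)
    (a b : W) {z : W → Fin (2 * p + 1) → ℤˣ} (h : ¬ ∀ x, Frozen (z x)) :
    ‖coeffTerm p (betaAngles p ψ) a b z‖ ≤ |ψ| := by
  obtain ⟨x, hx⟩ := not_forall.1 h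
  rw [coeffTerm, norm_mul, norm_mul, norm_units_cast, norm_units_cast, one_mul, one_mul]
  exact norm_prod_le_of_mem (Finset.mem_univ x) (fun y _ => norm_kernel_le_one _ _)
    (norm_kernel_le_of_not_frozen ψ hx)

theorem norm_sum_not_frozen_le {W : Type} [Fintype W] [DecidableEq W] {p : ℕ} (ψ : ℝ) (a b : W)
    {S : Finset (W → Fin (2 * p + 1) → ℤˣ)} (hS : ∀ z ∈ S, ¬ ∀ x, Frozen (z x)) :
    ‖∑ z ∈ S, coeffTerm p (betaAngles p ψ) a b z‖ ≤ 2 ^ ((2 * p + 1) * Fintype.card W) * |ψ| := by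
  refine (norm_sum_le_of_le _ fun z hz => norm_coeffTerm_le_of_not_frozen ψ a b (hS z hz)).trans ?_
  rw [Finset.sum_const, nsmul_eq_mul]
  refine mul_le_mul_of_nonneg_right ?_ (abs_nonneg ψ)
  have h1 : S.card ≤ 2 ^ ((2 * p + 1) * Fintype.card W) := by
    refine (Finset.card_le_univ S).trans_eq ?_
    simp [pow_mul]
  exact_mod_cast h1

theorem pow_mul_lt_frozenWeight {n p : ℕ} (hp : 2 ≤ p) (hn : 8 * p + 2 ≤ n) :
    (2 : ℝ) ^ ((2 * p + 1) * n) * (1 / 2 ^ ((n ^ 2 + 1) / 2)) <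
      frozenWeight n p (1 / 2 ^ ((n ^ 2 + 1) / 2)) / 2 := by
  obtain ⟨q, rfl⟩ : ∃ q, p = q + 2 := ⟨p - 2, by omega⟩
  set ψ : ℝ := 1 / 2 ^ ((n ^ 2 + 1) / 2) with hψ
  have h0 : 0 ≤ ψ := by positivity
  have h1 : ψ ≤ 1 := by
    rw [hψ, div_le_one (by positivity)]
    exact one_le_pow₀ (by norm_num)
  have hcos : 1 / 2 ≤ Real.cos ψ := by
    have := Real.one_sub_sq_div_two_le_cos (x := ψ)
    nlinarith
  have hw : ((1 : ℝ) / 2 ^ (2 * q + 3)) ^ n ≤ frozenWeight n (q + 2) ψ := by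
    rw [frozenWeight, show q + 2 - 2 = q by omega]
    refine pow_le_pow_left₀ (by positivity) ?_ n
    calc (1 : ℝ) / 2 ^ (2 * q + 3) = 1 / 8 * (1 / 2) ^ (2 * q) := by
          rw [pow_add, div_pow, one_pow]; field_simp; norm_num
      _ ≤ _ := by gcongr
  refine lt_of_lt_of_le ?_ (div_le_div_of_nonneg_right hw (by norm_num))
  rw [hψ, mul_one_div, div_pow, one_pow, ← pow_mul, div_div, div_lt_div_iff₀ (by positivity)
    (by positivity), ← pow_succ, ← pow_add, one_mul]
  refine pow_lt_pow_right₀ (by norm_num) ?_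
  have h2 : (8 * (q + 2) + 2) * n ≤ n ^ 2 := by
    rw [pow_two]; exact Nat.mul_le_mul_right n hn
  have h3 : (2 * (q + 2) + 1) * n + ((2 * q + 3) * n + 1) = 4 * ((q + 2) * n) + 1 := by ring
  have h4 : (8 * (q + 2) + 2) * n = 8 * ((q + 2) * n) + 2 * n := by ring
  omega

end NormBound

section Trig

theorem cos_sq_pi_div_four_mul_odd {m : ℤ} (hm : Odd m) :
    Real.cos (Real.pi / 4 * m) ^ 2 = 1 / 2 := by
  obtain ⟨k, rfl⟩ := hm
  have h : Real.cos (2 * (Real.pi / 4 * ((2 * k + 1 : ℤ) : ℝ))) = 0 := by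
    rw [Real.cos_eq_zero_iff]
    exact ⟨k, by push_cast; ring⟩
  rw [Real.cos_sq, h]
  norm_num

theorem odd_sum_units {W : Type} [Fintype W] (hW : Odd (Fintype.card W)) (c : W → ℤˣ) :
    Odd (∑ x, (c x : ℤ)) := by
  have h : (2 : ℤ) ∣ ∑ x, ((c x : ℤ) - 1) := Finset.dvd_sum fun x _ => by
    rcases Int.units_eq_one_or (c x) with e | e <;> rw [e] <;> norm_num
  simp only [Finset.sum_sub_distrib, Finset.sum_const, Finset.card_univ, nsmul_eq_mul,
    mul_one] at h
  obtain ⟨k, hk⟩ := hW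
  obtain ⟨l, hl⟩ := h
  exact ⟨k + l, by rw [hk] at hl; push_cast at hl; linarith⟩

end Trig

section Pairing

theorem re_sum_of_pairing {ι : Type} {A : Finset ι} {f : ι → ℂ} {g : ι → ι} {θ : ι → ℝ}
    {κ c t : ℝ} (hg : ∀ z ∈ A, g z ∈ A) (hgg : ∀ z, g (g z) = z)
    (h : ∀ z ∈ A, f z + f (g z) = -(κ : ℂ) * (phase (θ z) * ((2 * c : ℝ) : ℂ)))
    (hθ : ∀ z ∈ A, Real.cos (θ z) = t) :
    (∑ z ∈ A, f z).re = -κ * c * t * A.card := by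
  have h1 : ∑ z ∈ A, f (g z) = ∑ z ∈ A, f z :=
    Finset.sum_nbij' g g hg hg (fun z _ => hgg z) (fun z _ => hgg z) fun _ _ => rfl
  have h2 : (∑ z ∈ A, (f z + f (g z))).re = -κ * (t * (2 * c)) * A.card := by
    rw [Finset.sum_congr rfl h, Complex.re_sum, Finset.sum_congr rfl (g := fun _ => -κ * (t * (2 * c)))
      fun z hz => ?_, Finset.sum_const, nsmul_eq_mul]
    · ring
    · rw [← Complex.ofReal_neg, Complex.re_ofReal_mul, Complex.re_mul_ofReal, phase_re, hθ z hz]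
  rw [Finset.sum_add_distrib, h1, Complex.add_re] at h2
  linarith

variable {W : Type} {p : ℕ}

/-- Negate all spins on the layers `-1, …, -(p - 1)`. -/
def flipInner (z : W → Fin (2 * p + 1) → ℤˣ) : W → Fin (2 * p + 1) → ℤˣ :=
  fun x i => if 1 ≤ (i : ℕ) ∧ (i : ℕ) < p then -z x i else z x i

theorem flipInner_flipInner (z : W → Fin (2 * p + 1) → ℤˣ) : flipInner (flipInner z) = z := by
  ext x i
  by_cases h : 1 ≤ (i : ℕ) ∧ (i : ℕ) < p <;> simp [flipInner, h]

theorem flipInner_inner (z : W → Fin (2 * p + 1) → ℤˣ) (x : W) {j : ℤ} (h1 : -(p : ℤ) < j)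
    (h2 : j < 0) : flipInner z x (lay p j) = -z x (lay p j) := by
  have h := lay_val (p := p) (j := j) (by omega) (by omega)
  exact if_pos ⟨by omega, by omega⟩

theorem flipInner_of_nonneg (z : W → Fin (2 * p + 1) → ℤˣ) (x : W) {j : ℤ} (h1 : 0 ≤ j)
    (h2 : j ≤ p) : flipInner z x (lay p j) = z x (lay p j) := by
  have h := lay_val (p := p) (j := j) (by omega) (by omega)
  exact if_neg (by omega)

theorem flipInner_bottom (z : W → Fin (2 * p + 1) → ℤˣ) (x : W) :
    flipInner z x (lay p (-(p : ℤ))) = z x (lay p (-(p : ℤ))) := by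
  have h := lay_val (p := p) (j := -(p : ℤ)) (by omega) (by omega)
  exact if_neg (by omega)

theorem frozen_flipInner {z : W → Fin (2 * p + 1) → ℤˣ} {x : W} (h : Frozen (z x)) :
    Frozen (flipInner z x) := by
  intro ℓ h1 h2
  rw [flipInner_of_nonneg z x (by omega) (by omega), flipInner_of_nonneg z x (by omega) (by omega),
    flipInner_inner z x (by omega) (by omega), flipInner_inner z x (by omega) (by omega),
    (h ℓ h1 h2).1, (h ℓ h1 h2).2]
  exact ⟨rfl, rfl⟩

theorem matchedAt_flipInner [DecidableEq W] {a b : W} {z : W → Fin (2 * p + 1) → ℤˣ} {x : W}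
    (h : MatchedAt a b z x) : MatchedAt a b (flipInner z) x := by
  unfold MatchedAt at h ⊢
  rw [flipInner_of_nonneg z x (by omega) le_rfl, flipInner_bottom, h]

theorem expnt_flipInner [Fintype W] [DecidableEq W] (H : SimpleGraph W) [DecidableRel H.Adj]
    (z : W → Fin (2 * p + 1) → ℤˣ) : expnt H p (flipInner z) = expnt H p z := by
  unfold expnt
  refine Finset.sum_congr rfl fun j hj => ?_
  rw [Finset.mem_Icc] at hj
  simp only [layerCut_eq_spinCut]
  congr 2
  · simp only [flipInner_of_nonneg z _ (j := (j : ℤ)) (by omega) (by omega)]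
  · rcases Nat.lt_or_ge j p with h | h
    · simp only [flipInner_inner z _ (j := -(j : ℤ)) (by omega) (by omega), spinCut_neg]
    · obtain rfl : j = p := by omega
      simp only [flipInner_bottom]

variable [Fintype W] [DecidableEq W]

theorem coeffTerm_add_flipInner (hp : 2 ≤ p) (ψ : ℝ) {a b : W} (hab : a ≠ b)
    {z : W → Fin (2 * p + 1) → ℤˣ} (hz : ∀ x, MatchedAt a b z x) (hf : ∀ x, Frozen (z x))
    (hs : z a (lay p p) = z b (lay p p)) :
    coeffTerm p (betaAngles p ψ) a b z + coeffTerm p (betaAngles p ψ) a b (flipInner z) =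
      -(frozenWeight (Fintype.card W) p ψ : ℂ) * (phase (-(Real.pi / 4) *
          ((∑ x, ((z x (lay p ((p : ℤ) - 1)) * z x (lay p p) : ℤˣ) : ℤ) : ℤ) : ℝ)) *
        ((2 * Real.cos (Real.pi / 4 * ((∑ x, ((z x (lay p (-(p : ℤ))) *
          z x (lay p (-((p : ℤ) - 1))) : ℤˣ) : ℤ) : ℤ) : ℝ)) : ℝ) : ℂ)) := by
  have hs' : flipInner z a (lay p p) = flipInner z b (lay p p) := by
    rw [flipInner_of_nonneg z a (by omega) le_rfl, flipInner_of_nonneg z b (by omega) le_rfl, hs]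
  have e1 : ∑ x, ((flipInner z x (lay p (-(p : ℤ))) *
      flipInner z x (lay p (-((p : ℤ) - 1))) : ℤˣ) : ℤ) =
      -∑ x, ((z x (lay p (-(p : ℤ))) * z x (lay p (-((p : ℤ) - 1))) : ℤˣ) : ℤ) := by
    rw [← Finset.sum_neg_distrib]
    refine Finset.sum_congr rfl fun x _ => ?_
    rw [flipInner_bottom, flipInner_inner z x (by omega) (by omega), mul_neg, Units.val_neg]
  have e2 : ∀ x, flipInner z x (lay p ((p : ℤ) - 1)) * flipInner z x (lay p p) =
      z x (lay p ((p : ℤ) - 1)) * z x (lay p p) := fun x => by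
    rw [flipInner_of_nonneg z x (by omega) le_rfl, flipInner_of_nonneg z x (by omega) (by omega)]
  rw [coeffTerm_of_frozen hp ψ hab hz hf hs, coeffTerm_of_frozen hp ψ hab
    (fun x => matchedAt_flipInner (hz x)) (fun x => frozen_flipInner (hf x)) hs', e1]
  simp only [e2]
  rw [← phase_add_phase_neg, Int.cast_neg, mul_neg (Real.pi / 4)]
  ring

end Pairing

section Extremal

theorem xzero_ne_yzero {V : Type} {n0 : ℕ} (hn0 : 0 < n0) : xzero V n0 hn0 ≠ yzero V n0 hn0 := by
  simp [xzero, yzero]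

theorem anchorFlip_xzero {V : Type} [DecidableEq V] {n0 : ℕ} (hn0 : 0 < n0) : anchorFlip V n0 hn0 (xzero V n0 hn0) = -1 :=
  if_pos (Or.inl rfl)

theorem anchorFlip_yzero {V : Type} [DecidableEq V] {n0 : ℕ} (hn0 : 0 < n0) : anchorFlip V n0 hn0 (yzero V n0 hn0) = -1 :=
  if_pos (Or.inr rfl)

variable {V : Type} [Fintype V] [DecidableEq V] {n0 p : ℕ} (G : SimpleGraph V) [DecidableRel G.Adj]

/-- The largest exponent. -/
def topExponent (n0 p : ℕ) : ℤ :=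
  ((p : ℤ) - 1) * (maxCut (Gp n0 G) : ℤ) + 200 * (n0 : ℤ) ^ 2 + 2 * (n0 : ℤ) * (11 * (n0 : ℤ) + 1)

theorem topExponent_eq (hn0 : 0 < n0) (hV : Fintype.card V = n0) :
    topExponent G n0 p = ((p : ℤ) - 1) * (maxCut (Gp n0 G) : ℤ) +
      spinCut (Gp n0 G) (anchorFlip V n0 hn0) := by
  rw [spinCut_anchorFlip G hn0 hV, topExponent]
  ring

theorem expnt_le_topExponent (hp : 2 ≤ p) (hn0 : 0 < n0) (hV : Fintype.card V = n0)
    {z : GPV V n0 → Fin (2 * p + 1) → ℤˣ}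
    (hz : ∀ x, MatchedAt (xzero V n0 hn0) (yzero V n0 hn0) z x) :
    expnt (Gp n0 G) p z ≤ topExponent G n0 p := by
  rw [topExponent_eq G hn0 hV]
  exact expnt_le_of_eq_mul _ hp hz

theorem extremal_layers (hp : 2 ≤ p) (hn0 : 0 < n0) (hV : Fintype.card V = n0)
    {z : GPV V n0 → Fin (2 * p + 1) → ℤˣ}
    (hz : ∀ x, MatchedAt (xzero V n0 hn0) (yzero V n0 hn0) z x)
    (hD : expnt (Gp n0 G) p z = topExponent G n0 p) :
    ∃ s s' : ℤˣ, (∀ x, z x (lay p p) = anchorFlip V n0 hn0 x * s) ∧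
      (∀ x, z x (lay p (-(p : ℤ))) = s) ∧ (∀ x, z x (lay p (-((p : ℤ) - 1))) = s') ∧
      spinCut (Gp n0 G) (fun x => z x (lay p ((p : ℤ) - 1))) = maxCut (Gp n0 G) := by
  rw [topExponent_eq G hn0 hV, expnt_eq_iff_of_eq_mul (χ := anchorFlip V n0 hn0) _ hp hz] at hD
  obtain ⟨h1, h2⟩ := hD
  obtain ⟨h3, h4⟩ := h1 (p - 1) (by omega) le_rfl
  rw [show ((p - 1 : ℕ) : ℤ) = (p : ℤ) - 1 by omega] at h3 h4
  obtain ⟨u⟩ : Nonempty V := Fintype.card_pos_iff.1 (by omega)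
  have hz' : ∀ x, z x (lay p p) = anchorFlip V n0 hn0 x * z x (lay p (-(p : ℤ))) := hz
  have hbot : ∀ x, z x (lay p (-(p : ℤ))) = z (xzero V n0 hn0) (lay p (-(p : ℤ))) :=
    eq_anchor_of_forall_adj (v := fun x => z x (lay p (-(p : ℤ)))) G hn0
      (fun a b hab hχ => eq_of_spinCut_mul_eq (v := fun x => z x (lay p (-(p : ℤ)))) _
        (by rw [← Nat.cast_add, ← h2, funext hz']) hab hχ) u
  refine ⟨_, _, fun x => ?_, hbot, eq_anchor_of_forall_adj
    (v := fun x => z x (lay p (-((p : ℤ) - 1)))) G hn0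
    (fun a b hab _ => eq_of_spinCut_eq_zero _ h4 hab) u, h3⟩
  rw [← hbot x]
  exact hz x

theorem sum_mul_anchorFlip (hn0 : 0 < n0) {c : GPV V n0 → ℤˣ}
    (hc : (c (xzero V n0 hn0) : ℤ) + c (yzero V n0 hn0) = 0) :
    ∑ x, ((c x * anchorFlip V n0 hn0 x : ℤˣ) : ℤ) = ∑ x, (c x : ℤ) := by
  have h : ∀ x, ((c x * anchorFlip V n0 hn0 x : ℤˣ) : ℤ) = (c x : ℤ) -
      2 * ((if x = xzero V n0 hn0 then (c (xzero V n0 hn0) : ℤ) else 0) +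
        if x = yzero V n0 hn0 then (c (yzero V n0 hn0) : ℤ) else 0) := fun x => by
    have hne := xzero_ne_yzero (V := V) hn0
    unfold anchorFlip
    by_cases hx : x = xzero V n0 hn0
    · subst hx
      simp only [true_or, if_true, if_neg hne, mul_neg, mul_one, Units.val_neg]
      ring
    · by_cases hy : x = yzero V n0 hn0
      · subst hy
        simp only [or_true, if_true, if_neg hx, mul_neg, mul_one, Units.val_neg]
        ring
      · simp [hx, hy]
  simp only [h, Finset.sum_sub_distrib, ← Finset.mul_sum, Finset.sum_add_distrib,
    Finset.sum_ite_eq', Finset.mem_univ, if_true]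
  rw [hc]
  ring

theorem cos_pi_div_four_mul_eq {T τ : ℤ} (h : T = τ ∨ T = -τ) :
    Real.cos (Real.pi / 4 * T) = Real.cos (Real.pi / 4 * τ) := by
  rcases h with rfl | rfl
  · rfl
  · rw [Int.cast_neg, mul_neg, Real.cos_neg]

theorem exists_extremal_frozen (hp : 2 ≤ p) (hn0 : 0 < n0) (hV : Fintype.card V = n0) :
    ∃ z : GPV V n0 → Fin (2 * p + 1) → ℤˣ, expnt (Gp n0 G) p z = topExponent G n0 p ∧
      (∀ x, MatchedAt (xzero V n0 hn0) (yzero V n0 hn0) z x) ∧ ∀ x, Frozen (z x) := by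
  obtain ⟨c, hc⟩ := exists_spinCut_eq_maxCut (Gp n0 G)
  let z : GPV V n0 → Fin (2 * p + 1) → ℤˣ := fun x i =>
    if (i : ℕ) ≤ p then 1 else if (i : ℕ) = 2 * p then anchorFlip V n0 hn0 x else c x
  have hneg : ∀ x (j : ℤ), -(p : ℤ) ≤ j → j ≤ 0 → z x (lay p j) = 1 := fun x j h1 h2 => by
    have h := lay_val (p := p) (j := j) (by omega) (by omega)
    exact if_pos (by omega)
  have hpos : ∀ x (j : ℤ), 0 < j → j < p → z x (lay p j) = c x := fun x j h1 h2 => by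
    have h := lay_val (p := p) (j := j) (by omega) (by omega)
    simp only [z]
    rw [if_neg (by omega), if_neg (by omega)]
  have htop : ∀ x, z x (lay p p) = anchorFlip V n0 hn0 x := fun x => by
    have h := lay_val (p := p) (j := p) (by omega) (by omega)
    simp only [z]
    rw [if_neg (by omega), if_pos (by omega)]
  have hz : ∀ x, MatchedAt (xzero V n0 hn0) (yzero V n0 hn0) z x := fun x => by
    unfold MatchedAt
    rw [htop, hneg x _ (by omega) (by omega), mul_one]
    rfl
  refine ⟨z, ?_, hz, fun x ℓ h1 h2 => ?_⟩
  · rw [topExponent_eq G hn0 hV, expnt_eq_iff_of_eq_mul (χ := anchorFlip V n0 hn0) _ hp hz]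
    refine ⟨fun j h1 h2 => ⟨?_, ?_⟩, ?_⟩
    · simp only [hpos _ (j : ℤ) (by omega) (by omega)]
      exact hc
    · simp only [hneg _ (-(j : ℤ)) (by omega) (by omega)]
      exact spinCut_const _ 1
    · simp only [hneg _ (-(p : ℤ)) (by omega) (by omega), htop, spinCut_const]
      simp
  · rw [hpos x _ (by omega) (by omega), hpos x _ (by omega) (by omega),
      hneg x _ (by omega) (by omega), hneg x _ (by omega) (by omega)]
    exact ⟨rfl, rfl⟩

open Classical in
theorem frozenWeight_le_norm_sum (hp : 2 ≤ p) (hn0 : 0 < n0) (hV : Fintype.card V = n0) {ψ : ℝ}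
    (hψ : 0 ≤ frozenWeight (Fintype.card (GPV V n0)) p ψ) :
    frozenWeight (Fintype.card (GPV V n0)) p ψ / 2 ≤
      ‖∑ z ∈ Finset.univ.filter (fun z : GPV V n0 → Fin (2 * p + 1) → ℤˣ =>
        (expnt (Gp n0 G) p z = topExponent G n0 p ∧
          ∀ x, MatchedAt (xzero V n0 hn0) (yzero V n0 hn0) z x) ∧ ∀ x, Frozen (z x)),
        coeffTerm p (betaAngles p ψ) (xzero V n0 hn0) (yzero V n0 hn0) z‖ := by
  set A := Finset.univ.filter (fun z : GPV V n0 → Fin (2 * p + 1) → ℤˣ =>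
        (expnt (Gp n0 G) p z = topExponent G n0 p ∧
          ∀ x, MatchedAt (xzero V n0 hn0) (yzero V n0 hn0) z x) ∧ ∀ x, Frozen (z x)) with hA
  obtain ⟨τ, hτ⟩ := exists_sum_eq_of_maxCut G hn0 hV
  have hodd : Odd (Fintype.card (GPV V n0)) := by
    rw [card_GPV hV]
    obtain ⟨m, hm⟩ := Nat.even_mul_succ_self n0
    exact ⟨105 * n0 ^ 2 + m, by nlinarith⟩
  have hτodd : Odd τ := by
    obtain ⟨c, hc⟩ := exists_spinCut_eq_maxCut (Gp n0 G)
    have h := odd_sum_units hodd c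
    rcases (hτ c hc).2 with e | e <;> rw [e] at h
    · exact h
    · exact odd_neg.1 h
  have hre := re_sum_of_pairing (A := A)
    (f := coeffTerm p (betaAngles p ψ) (xzero V n0 hn0) (yzero V n0 hn0)) (g := flipInner)
    (θ := fun z => -(Real.pi / 4) *
      ((∑ x, ((z x (lay p ((p : ℤ) - 1)) * z x (lay p p) : ℤˣ) : ℤ) : ℤ) : ℝ))
    (κ := frozenWeight (Fintype.card (GPV V n0)) p ψ)
    (c := Real.cos (Real.pi / 4 * ((Fintype.card (GPV V n0) : ℤ) : ℝ)))
    (t := Real.cos (Real.pi / 4 * τ)) ?_ flipInner_flipInner ?_ ?_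
  · have hc1 := cos_sq_pi_div_four_mul_odd ((Int.odd_coe_nat _).2 hodd)
    have hc2 := cos_sq_pi_div_four_mul_odd hτodd
    have hA1 : (1 : ℝ) ≤ A.card := by
      obtain ⟨z, h1, h2, h3⟩ := exists_extremal_frozen G hp hn0 hV
      have : 0 < A.card := Finset.card_pos.2 ⟨z, by simp [hA, h1, h2, h3]⟩
      exact_mod_cast this
    refine le_trans ?_ (Complex.abs_re_le_norm _)
    rw [hre]
    set c1 := Real.cos (Real.pi / 4 * ((Fintype.card (GPV V n0) : ℤ) : ℝ))
    set c2 := Real.cos (Real.pi / 4 * τ)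
    have h12 : |c1 * c2| = 1 / 2 := by
      rw [← Real.sqrt_sq_eq_abs, mul_pow, hc1, hc2, Real.sqrt_eq_iff_mul_self_eq] <;> norm_num
    rw [show ∀ κ m : ℝ, -κ * c1 * c2 * m = -(κ * m * (c1 * c2)) by intros; ring, abs_neg, abs_mul,
      h12, abs_of_nonneg (by positivity)]
    nlinarith
  · intro z hz
    simp only [hA, Finset.mem_filter, Finset.mem_univ, true_and] at hz ⊢
    exact ⟨⟨(expnt_flipInner _ z).trans hz.1.1, fun x => matchedAt_flipInner (hz.1.2 x)⟩,
      fun x => frozen_flipInner (hz.2 x)⟩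
  · intro z hz
    simp only [hA, Finset.mem_filter, Finset.mem_univ, true_and] at hz
    obtain ⟨s, s', h1, h2, h3, -⟩ := extremal_layers G hp hn0 hV hz.1.2 hz.1.1
    rw [coeffTerm_add_flipInner hp ψ (xzero_ne_yzero hn0) hz.1.2 hz.2
      (by rw [h1, h1, anchorFlip_xzero, anchorFlip_yzero])]
    congr 4
    refine cos_pi_div_four_mul_eq ?_
    simp only [h2, h3, Finset.sum_const, Finset.card_univ, nsmul_eq_mul]
    rcases Int.units_eq_one_or (s * s') with e | e <;> simp [e]
  · intro z hz
    simp only [hA, Finset.mem_filter, Finset.mem_univ, true_and] at hz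
    obtain ⟨s, s', h1, -, -, h4⟩ := extremal_layers G hp hn0 hV hz.1.2 hz.1.1
    obtain ⟨h5, h6⟩ := hτ _ h4
    rw [neg_mul, Real.cos_neg]
    refine cos_pi_div_four_mul_eq ?_
    have h7 : ∑ x, ((z x (lay p ((p : ℤ) - 1)) * z x (lay p p) : ℤˣ) : ℤ) =
        s * ∑ x, (z x (lay p ((p : ℤ) - 1)) : ℤ) := by
      rw [← sum_mul_anchorFlip hn0 (c := fun x => z x (lay p ((p : ℤ) - 1))) h5, Finset.mul_sum]
      refine Finset.sum_congr rfl fun x _ => ?_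
      rw [h1]
      push_cast
      ring
    rw [h7]
    rcases Int.units_eq_one_or s with rfl | rfl <;> rcases h6 with e | e <;> simp [e]

end Extremal

theorem largest_nonzero_exponent (p : ℕ) (hp : 2 ≤ p) :
    ∃ N : ℕ, ∀ n0 : ℕ, N ≤ n0 → ∀ hn0 : 0 < n0,
    ∀ (V : Type) [Fintype V] [DecidableEq V], Fintype.card V = n0 →
    ∀ (G : SimpleGraph V) [DecidableRel G.Adj],
    let n : ℕ := 211 * n0 ^ 2 + n0 + 1
    let ψ : ℝ := 1 / 2 ^ ((n ^ 2 + 1) / 2)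
    let Dmax : ℤ := ((p : ℤ) - 1) * (maxCut (Gp n0 G) : ℤ) + 200 * (n0 : ℤ) ^ 2
        + 2 * (n0 : ℤ) * (11 * (n0 : ℤ) + 1)
    let w : ℤ → ℂ := fun k =>
      ∑ z ∈ Finset.univ.filter (fun z : GPV V n0 → Fin (2 * p + 1) → ℤˣ =>
          expnt (Gp n0 G) p z = k),
        coeffTerm p (betaAngles p ψ) (xzero V n0 hn0) (yzero V n0 hn0) z
    (∀ k : ℤ, Dmax < k → w k = 0) ∧ w Dmax ≠ 0 := by
  classical
  refine ⟨8 * p + 2, fun n0 hn hn0 V _ _ hV G _ => ?_⟩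
  intro n ψ Dmax w
  have hD : Dmax = topExponent G n0 p := rfl
  have hab := xzero_ne_yzero (V := V) hn0
  have hw : ∀ k, w k = _ := fun k => sum_expnt_eq_sum_matched (Gp n0 G) (by omega) ψ hab k
  refine ⟨fun k hk => ?_, fun h0 => ?_⟩
  · rw [hw]
    refine Finset.sum_eq_zero fun z hz => ?_
    rw [Finset.mem_filter] at hz
    have := expnt_le_topExponent G hp hn0 hV hz.2.2
    omega
  · have hcard : Fintype.card (GPV V n0) = n := card_GPV hV
    have hnn : 8 * p + 2 ≤ n := by
      simp only [n]
      omega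
    have hlt := pow_mul_lt_frozenWeight hp hnn
    have hψ0 : 0 ≤ ψ := by positivity
    have hpos : 0 ≤ frozenWeight n p ψ := by
      have : (0 : ℝ) ≤ 2 ^ ((2 * p + 1) * n) * ψ := by positivity
      linarith
    have hmain := frozenWeight_le_norm_sum G hp hn0 hV (ψ := ψ) (by rwa [hcard])
    rw [hw, ← Finset.sum_filter_add_sum_filter_not _ (fun z => ∀ x, Frozen (z x)),
      Finset.filter_filter, Finset.filter_filter, hD] at h0
    rw [eq_neg_of_add_eq_zero_left h0, norm_neg, hcard] at hmain
    have herr := hmain.trans (norm_sum_not_frozen_le ψ _ _ fun z hz => (Finset.mem_filter.1 hz).2.2)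
    rw [hcard, abs_of_nonneg hψ0] at herr
    exact absurd hlt (not_lt.2 herr)

end QAOA
end
end

section
/- Let S be any subset of V(G') with cut_{G'}(S) = MAXCUT(G') (a maximum cut of G'). Then for every vertex u ∈ V(G), the gadget B(u) is separated along its bipartition: either L_u ⊆ S and R_u ⊆ V(G') \ S, or R_u ⊆ S and L_u ⊆ V(G') \ S. -/
/-!
STATEMENT 7: in any maximum cut of G′, each gadget B(u) is separated along its
bipartition (L_u, R_u).
-/
noncomputable section

namespace QAOA

section Cut

variable {W : Type} [Fintype W] [DecidableEq W] (H : SimpleGraph W) [DecidableRel H.Adj]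

/-- Ordered pairs of adjacent vertices separated by `S`. -/
def cutPairs (S : Finset W) : Finset (W × W) :=
  Finset.univ.filter (fun pr : W × W => H.Adj pr.1 pr.2 ∧ ¬ (pr.1 ∈ S ↔ pr.2 ∈ S))

theorem card_cutPairs (S : Finset W) : (cutPairs H S).card = 2 * cutSet H S := by
  have hsplit : cutPairs H S =
      Finset.univ.filter (fun pr : W × W => H.Adj pr.1 pr.2 ∧ pr.1 ∈ S ∧ pr.2 ∉ S) ∪
      (Finset.univ.filter
        (fun pr : W × W => H.Adj pr.1 pr.2 ∧ pr.1 ∈ S ∧ pr.2 ∉ S)).map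
          (Equiv.prodComm W W).toEmbedding := by
    ext ⟨a, b⟩
    simp only [cutPairs, Finset.mem_filter, Finset.mem_univ, true_and, Finset.mem_union,
      Finset.mem_map_equiv, Equiv.prodComm_symm, Equiv.prodComm_apply, Prod.swap_prod_mk,
      H.adj_comm b a]
    tauto
  rw [hsplit, Finset.card_union_of_disjoint, Finset.card_map, cutSet, two_mul]
  rw [Finset.disjoint_left]
  rintro ⟨a, b⟩ h₁ h₂
  simp only [Finset.mem_filter, Finset.mem_univ, true_and, Finset.mem_map_equiv,
    Equiv.prodComm_symm, Equiv.prodComm_apply, Prod.swap_prod_mk] at h₁ h₂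
  exact h₂.2.2 h₁.2.1

theorem cutSet_compl (S : Finset W) : cutSet H Sᶜ = cutSet H S := by
  have h : cutPairs H Sᶜ = cutPairs H S := by
    ext ⟨a, b⟩
    simp only [cutPairs, Finset.mem_filter, Finset.mem_univ, true_and, Finset.mem_compl]
    tauto
  have h₁ := card_cutPairs H S
  have h₂ := card_cutPairs H Sᶜ
  rw [h] at h₂
  omega

theorem cutSet_erase {S : Finset W} {v : W} (hv : v ∈ S) :
    cutSet H (S.erase v) + (Finset.univ.filter (fun b => H.Adj v b ∧ b ∉ S)).card =
      cutSet H S + (Finset.univ.filter (fun b => H.Adj v b ∧ b ∈ S)).card := by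
  rw [← Finset.card_image_of_injective
      (Finset.univ.filter (fun b => H.Adj v b ∧ b ∉ S)) (Prod.mk_right_injective v),
    ← Finset.card_image_of_injective
      (Finset.univ.filter (fun b => H.Adj v b ∧ b ∈ S)) (Prod.mk_left_injective v),
    cutSet, cutSet, ← Finset.card_union_of_disjoint, ← Finset.card_union_of_disjoint]
  · congr 1
    ext ⟨a, b⟩
    simp only [Finset.mem_union, Finset.mem_filter, Finset.mem_univ, true_and, Finset.mem_erase,
      Finset.mem_image, Prod.mk.injEq]
    constructor
    · rintro (⟨h₁, ⟨h₂, h₃⟩, h₄⟩ | ⟨c, ⟨h₁, h₂⟩, rfl, rfl⟩)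
      · by_cases hb : b = v
        · subst hb
          exact Or.inr ⟨a, ⟨h₁.symm, h₃⟩, rfl, rfl⟩
        · exact Or.inl ⟨h₁, h₃, fun h => h₄ ⟨hb, h⟩⟩
      · exact Or.inl ⟨h₁, hv, h₂⟩
    · rintro (⟨h₁, h₂, h₃⟩ | ⟨c, ⟨h₁, h₂⟩, rfl, rfl⟩)
      · by_cases ha : a = v
        · subst ha
          exact Or.inr ⟨b, ⟨h₁, h₃⟩, rfl, rfl⟩
        · exact Or.inl ⟨h₁, ⟨ha, h₂⟩, fun h => h₃ h.2⟩
      · exact Or.inl ⟨h₁.symm, ⟨h₁.ne', h₂⟩, fun h => h.1 rfl⟩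
  · rw [Finset.disjoint_left]
    rintro ⟨a, b⟩ h₁ h₂
    simp only [Finset.mem_filter, Finset.mem_univ, true_and, Finset.mem_image,
      Prod.mk.injEq] at h₁ h₂
    obtain ⟨c, -, -, rfl⟩ := h₂
    exact h₁.2.2 hv
  · rw [Finset.disjoint_left]
    rintro ⟨a, b⟩ h₁ h₂
    simp only [Finset.mem_filter, Finset.mem_univ, true_and, Finset.mem_image,
      Prod.mk.injEq, Finset.mem_erase] at h₁ h₂
    obtain ⟨c, -, rfl, -⟩ := h₂
    exact h₁.2.1.1 rfl

/-- `S` attains the maximum cut of `H`. -/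
def IsMaxCut (S : Finset W) : Prop := ∀ T, cutSet H T ≤ cutSet H S

variable {H}

theorem isMaxCut_of_cutSet_eq {S : Finset W} (h : cutSet H S = maxCut H) : IsMaxCut H S :=
  fun T => h ▸ Finset.le_sup (f := fun S => cutSet H S) (Finset.mem_univ T)

theorem IsMaxCut.compl {S : Finset W} (h : IsMaxCut H S) : IsMaxCut H Sᶜ :=
  fun T => (cutSet_compl H S).symm ▸ h T

theorem IsMaxCut.card_mem_le {S : Finset W} (h : IsMaxCut H S) {v : W} (hv : v ∈ S) :
    (Finset.univ.filter (fun b => H.Adj v b ∧ b ∈ S)).card ≤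
      (Finset.univ.filter (fun b => H.Adj v b ∧ b ∉ S)).card := by
  have := cutSet_erase H hv
  have := h (S.erase v)
  omega

theorem IsMaxCut.card_notMem_le {S : Finset W} (h : IsMaxCut H S) {v : W} (hv : v ∉ S) :
    (Finset.univ.filter (fun b => H.Adj v b ∧ b ∉ S)).card ≤
      (Finset.univ.filter (fun b => H.Adj v b ∧ b ∈ S)).card := by
  simpa using h.compl.card_mem_le (Finset.mem_compl.2 hv)

theorem IsMaxCut.erase {S : Finset W} (h : IsMaxCut H S) {v : W}
    (hle : (Finset.univ.filter (fun b => H.Adj v b ∧ b ∉ S)).card ≤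
      (Finset.univ.filter (fun b => H.Adj v b ∧ b ∈ S)).card) :
    IsMaxCut H (S.erase v) := by
  by_cases hv : v ∈ S
  · have := cutSet_erase H hv
    intro T
    have := h T
    omega
  · rwa [Finset.erase_eq_of_notMem hv]

end Cut

section Gadget

variable {V : Type} [DecidableEq V] {n0 : ℕ} {G : SimpleGraph V} [DecidableRel G.Adj]

/-- The neighbours of `R u j` are `x₀`, `y₀` and the vertices `L u i`. -/
theorem adj_R_iff (hn0 : 0 < n0) (u : V) (j : Fin (10 * n0)) (b : GPV V n0) :
    (Gp n0 G).Adj (.R u j) b ↔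
      (∃ i, b = .L u i) ∨ b = xzero V n0 hn0 ∨ b = yzero V n0 hn0 := by
  cases b <;> simp [Gp, gpRel, xzero, yzero, Fin.ext_iff, eq_comm (a := u)]

variable [Fintype V]

/-- Filtering the neighbourhood of `R u j`, when `p` holds at exactly one of `x₀` and `y₀`. -/
theorem card_filter_adj_R (hn0 : 0 < n0) (u : V) (j : Fin (10 * n0)) (p : GPV V n0 → Prop)
    [DecidablePred p] (hp : ¬ (p (xzero V n0 hn0) ↔ p (yzero V n0 hn0))) :
    (Finset.univ.filter (fun b => (Gp n0 G).Adj (.R u j) b ∧ p b)).card =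
      (Finset.univ.filter (fun i => p (.L u i))).card + 1 := by
  have hinj : Function.Injective (fun i => (GPV.L u i : GPV V n0)) := by
    intro i i' h
    simpa using h
  rw [← Finset.card_image_of_injective _ hinj]
  obtain ⟨z, hz, hpz⟩ : ∃ z : GPV V n0, (∀ i, z ≠ .L u i) ∧
      ∀ b, (b = xzero V n0 hn0 ∨ b = yzero V n0 hn0) ∧ p b ↔ b = z := by
    by_cases hx : p (xzero V n0 hn0)
    · refine ⟨xzero V n0 hn0, by simp [xzero], fun b => ⟨?_, ?_⟩⟩
      · rintro ⟨rfl | rfl, h⟩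
        · rfl
        · tauto
      · rintro rfl
        exact ⟨Or.inl rfl, hx⟩
    · refine ⟨yzero V n0 hn0, by simp [yzero], fun b => ⟨?_, ?_⟩⟩
      · rintro ⟨rfl | rfl, h⟩
        · tauto
        · rfl
      · rintro rfl
        exact ⟨Or.inr rfl, by tauto⟩
  rw [← Finset.card_insert_of_notMem (a := z)]
  · congr 1
    ext b
    simp only [Finset.mem_filter, Finset.mem_univ, true_and, Finset.mem_insert, Finset.mem_image,
      adj_R_iff hn0, ← hpz b]
    constructor
    · rintro ⟨⟨i, rfl⟩ | h, hb⟩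
      · exact Or.inr ⟨i, hb, rfl⟩
      · exact Or.inl ⟨h, hb⟩
    · rintro (⟨h, hb⟩ | ⟨i, hb, rfl⟩)
      · exact ⟨Or.inr h, hb⟩
      · exact ⟨Or.inl ⟨i, rfl⟩, hb⟩
  · simp only [Finset.mem_image, not_exists, not_and]
    exact fun i _ h => hz i h.symm

theorem IsMaxCut.sdiff_image_R (hn0 : 0 < n0) {S : Finset (GPV V n0)}
    (h : IsMaxCut (Gp n0 G) S) (hxy : ¬ (xzero V n0 hn0 ∈ S ↔ yzero V n0 hn0 ∈ S)) (u : V)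
    (hmaj : (Finset.univ.filter (fun i => GPV.L u i ∉ S)).card ≤
      (Finset.univ.filter (fun i => GPV.L u i ∈ S)).card) (T : Finset (Fin (10 * n0))) :
    IsMaxCut (Gp n0 G) (S \ T.image (GPV.R u)) := by
  induction T using Finset.induction_on with
  | empty => simpa using h
  | insert j T _ ih =>
    rw [Finset.image_insert, Finset.sdiff_insert]
    apply ih.erase
    rw [card_filter_adj_R hn0 u j _ (by simpa [xzero, yzero] using not_iff_not.not.2 hxy),
      card_filter_adj_R hn0 u j _ (by simpa [xzero, yzero] using hxy)]
    simpa using hmaj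

theorem IsMaxCut.L_mem_of_R_notMem (hn0 : 0 < n0) (hV : Fintype.card V = n0)
    {S : Finset (GPV V n0)} (h : IsMaxCut (Gp n0 G) S) (u : V)
    (hR : ∀ j, GPV.R (n0 := n0) u j ∉ S) (i : Fin (n0 + 1)) : GPV.L u i ∈ S := by
  by_contra hi
  have hinj : Function.Injective (fun j => (GPV.R u j : GPV V n0)) := by
    intro j j' h
    simpa using h
  have hlow : 10 * n0 ≤
      (Finset.univ.filter (fun b => (Gp n0 G).Adj (.L u i) b ∧ b ∉ S)).card := by
    calc 10 * n0 = (Finset.univ.image (fun j => (GPV.R u j : GPV V n0))).card := by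
          rw [Finset.card_image_of_injective _ hinj, Finset.card_univ, Fintype.card_fin]
      _ ≤ _ := by
          apply Finset.card_le_card
          intro b hb
          obtain ⟨j, -, rfl⟩ := Finset.mem_image.1 hb
          simp [Gp, gpRel, hR]
  have hup : (Finset.univ.filter (fun b => (Gp n0 G).Adj (.L u i) b ∧ b ∈ S)).card ≤ n0 + 3 := by
    calc _ ≤ (Finset.univ.image (fun v => (GPV.L v i : GPV V n0)) ∪
          {xzero V n0 hn0, yzero V n0 hn0, GPV.W}).card := by
          apply Finset.card_le_card
          intro b hb
          obtain ⟨hb, hbS⟩ := (Finset.mem_filter.1 hb).2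
          cases b with
          | R v j =>
            have : u = v := by simpa [Gp, gpRel] using hb
            exact absurd hbS (this ▸ hR j)
          | L v k =>
            have : i = k := by
              simp only [Gp, gpRel, SimpleGraph.fromRel_adj, Bool.and_eq_true, beq_iff_eq] at hb
              exact Fin.ext (by rcases hb.2 with h | h <;> simp [h.2])
            simp [this]
          | _ =>
            simp_all [Gp, gpRel, xzero, yzero, Fin.ext_iff, -Fin.val_eq_zero_iff]
      _ ≤ n0 + 3 := by
          refine (Finset.card_union_le _ _).trans (Nat.add_le_add ?_ Finset.card_le_three)
          exact Finset.card_image_le.trans (by rw [Finset.card_univ, hV])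
  have := h.card_notMem_le hi
  omega

theorem IsMaxCut.separated_of_majority (hn0 : 0 < n0) (hV : Fintype.card V = n0)
    {S : Finset (GPV V n0)} (h : IsMaxCut (Gp n0 G) S)
    (hxy : ¬ (xzero V n0 hn0 ∈ S ↔ yzero V n0 hn0 ∈ S)) (u : V)
    (hmaj : (Finset.univ.filter (fun i => GPV.L u i ∉ S)).card ≤
      (Finset.univ.filter (fun i => GPV.L u i ∈ S)).card) :
    (∀ i, GPV.L u i ∈ S) ∧ (∀ j, GPV.R (n0 := n0) u j ∉ S) := by
  have hL : ∀ i, GPV.L u i ∈ S := fun i => by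
    simpa using (h.sdiff_image_R hn0 hxy u hmaj Finset.univ).L_mem_of_R_notMem hn0 hV u
      (by simp) i
  refine ⟨hL, fun j hj => ?_⟩
  have hle := h.card_mem_le hj
  rw [card_filter_adj_R hn0 u j _ hxy,
    card_filter_adj_R hn0 u j _ (by rwa [not_iff_not])] at hle
  simp [hL] at hle

/-- The gadget vertices together with the controller. -/
def offFrame (V : Type) [Fintype V] [DecidableEq V] (n0 : ℕ) : Finset (GPV V n0) :=
  insert .W (Finset.univ.image (fun q : V × Fin (n0 + 1) => .L q.1 q.2) ∪
    Finset.univ.image (fun q : V × Fin (10 * n0) => .R q.1 q.2))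

theorem card_offFrame_le (hV : Fintype.card V = n0) :
    (offFrame V n0).card ≤ n0 * (n0 + 1) + n0 * (10 * n0) + 1 := by
  refine (Finset.card_insert_le _ _).trans (Nat.succ_le_succ ?_)
  refine (Finset.card_union_le _ _).trans (Nat.add_le_add ?_ ?_) <;>
  exact Finset.card_image_le.trans (by simp [hV])

/-- Replace the frame part of `S` by the side `X`. -/
def resetFrame (S : Finset (GPV V n0)) : Finset (GPV V n0) :=
  (S ∩ offFrame V n0) ∪ Finset.univ.image .X

theorem cutPairs_sdiff_resetFrame_subset (hn0 : 0 < n0) (S : Finset (GPV V n0)) :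
    cutPairs (Gp n0 G) S \ cutPairs (Gp n0 G) (resetFrame S) ⊆
      ({xzero V n0 hn0, yzero V n0 hn0} ×ˢ offFrame V n0) ∪
      (offFrame V n0 ×ˢ {xzero V n0 hn0, yzero V n0 hn0}) := by
  rintro ⟨a, b⟩ hab
  simp only [cutPairs, Finset.mem_sdiff, Finset.mem_filter, Finset.mem_univ, true_and,
    not_and, not_not] at hab
  obtain ⟨⟨hadj, hne⟩, himp⟩ := hab
  have heq := himp hadj
  clear himp
  cases a <;> cases b <;>
    simp [Gp, gpRel, resetFrame, offFrame, xzero, yzero, Fin.ext_iff,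
      -Fin.val_eq_zero_iff] at hadj hne heq ⊢ <;> tauto

theorem card_frame_le_card_cutPairs_sdiff (hn0 : 0 < n0) {S : Finset (GPV V n0)}
    (hxy : xzero V n0 hn0 ∈ S ↔ yzero V n0 hn0 ∈ S) :
    100 * n0 * n0 ≤ (cutPairs (Gp n0 G) (resetFrame S) \ cutPairs (Gp n0 G) S).card := by
  classical
  have hpos : 0 < 100 * n0 * n0 := Nat.mul_pos (Nat.mul_pos (by norm_num) hn0) hn0
  let f : Fin (100 * n0 * n0) → GPV V n0 × GPV V n0 := fun i =>
    if GPV.X i ∈ S ↔ GPV.Y i ∈ S then (.X i, .Y i)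
    else if GPV.X i ∈ S ↔ yzero V n0 hn0 ∈ S then (.X i, yzero V n0 hn0)
    else (xzero V n0 hn0, .Y i)
  have hinj : Function.Injective f := by
    intro i k hik
    by_contra hne
    have hzero : f ⟨0, hpos⟩ = (.X ⟨0, hpos⟩, .Y ⟨0, hpos⟩) := if_pos hxy
    have hcases : ∀ m, f m = (.X m, .Y m) ∨ f m = (.X m, .Y ⟨0, hpos⟩) ∨
        f m = (.X ⟨0, hpos⟩, .Y m) := by
      intro m
      by_cases h₁ : GPV.X m ∈ S ↔ GPV.Y m ∈ S
      · exact Or.inl (if_pos h₁)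
      by_cases h₂ : GPV.X m ∈ S ↔ yzero V n0 hn0 ∈ S
      · exact Or.inr (Or.inl ((if_neg h₁).trans (if_pos h₂)))
      · exact Or.inr (Or.inr ((if_neg h₁).trans (if_neg h₂)))
    by_cases hi : i = ⟨0, hpos⟩ <;> by_cases hk : k = ⟨0, hpos⟩
    · exact hne (hi.trans hk.symm)
    · rw [hi, hzero] at hik
      rcases hcases k with h | h | h <;> rw [h] at hik <;> simp at hik <;> grind
    · rw [hk, hzero] at hik
      rcases hcases i with h | h | h <;> rw [h] at hik <;> simp at hik <;> grind
    · rcases hcases i with h | h | h <;> rcases hcases k with h' | h' | h' <;>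
        rw [h, h'] at hik <;> simp at hik <;> grind
  calc 100 * n0 * n0 = (Finset.univ.image f).card := by
        rw [Finset.card_image_of_injective _ hinj, Finset.card_univ, Fintype.card_fin]
    _ ≤ _ := by
        apply Finset.card_le_card
        intro p hp
        obtain ⟨i, -, rfl⟩ := Finset.mem_image.1 hp
        have hframe : ∀ i k, (GPV.X i ∈ S ↔ GPV.Y k ∈ S) →
            ((GPV.X i, GPV.Y k) : GPV V n0 × GPV V n0) ∈
              cutPairs (Gp n0 G) (resetFrame S) \ cutPairs (Gp n0 G) S := by
          intro i k h
          simp [cutPairs, resetFrame, offFrame, Gp, gpRel, h]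
        simp only [f]
        split_ifs with h₁ h₂
        · exact hframe _ _ h₁
        · exact hframe _ _ h₂
        · exact hframe _ _ (by rw [← xzero.eq_def V n0 hn0]; tauto)

theorem IsMaxCut.xzero_yzero_separated (hn0 : 0 < n0) (hV : Fintype.card V = n0)
    {S : Finset (GPV V n0)} (h : IsMaxCut (Gp n0 G) S) :
    ¬ (xzero V n0 hn0 ∈ S ↔ yzero V n0 hn0 ∈ S) := by
  intro hxy
  have hgain := card_frame_le_card_cutPairs_sdiff (G := G) hn0 hxy
  have hloss : (cutPairs (Gp n0 G) S \ cutPairs (Gp n0 G) (resetFrame S)).card ≤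
      2 * (offFrame V n0).card + (offFrame V n0).card * 2 := by
    refine (Finset.card_le_card (cutPairs_sdiff_resetFrame_subset hn0 S)).trans ?_
    refine (Finset.card_union_le _ _).trans (Nat.add_le_add ?_ ?_) <;> rw [Finset.card_product]
    · exact Nat.mul_le_mul_right _ Finset.card_le_two
    · exact Nat.mul_le_mul_left _ Finset.card_le_two
  have hoff := card_offFrame_le hV
  have hmax := h (resetFrame S)
  have hS := card_cutPairs (Gp n0 G) S
  have hS' := card_cutPairs (Gp n0 G) (resetFrame S)
  have hcomm := Finset.card_sdiff_add_card (cutPairs (Gp n0 G) S)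
    (cutPairs (Gp n0 G) (resetFrame S))
  have hcomm' := Finset.card_sdiff_add_card (cutPairs (Gp n0 G) (resetFrame S))
    (cutPairs (Gp n0 G) S)
  rw [Finset.union_comm] at hcomm'
  nlinarith

end Gadget

theorem gadget_separated_in_maxcut
    (n0 : ℕ) (hn0 : 0 < n0) {V : Type} [Fintype V] [DecidableEq V]
    (hV : Fintype.card V = n0) (G : SimpleGraph V) [DecidableRel G.Adj]
    (S : Finset (GPV V n0)) (hS : cutSet (Gp n0 G) S = maxCut (Gp n0 G)) :
    ∀ u : V,
      ((∀ i, GPV.L u i ∈ S) ∧ (∀ j, GPV.R (n0 := n0) u j ∉ S)) ∨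
      ((∀ j, GPV.R u j ∈ S) ∧ (∀ i, GPV.L (n0 := n0) u i ∉ S)) := by
  intro u
  have h := isMaxCut_of_cutSet_eq hS
  rcases le_total (Finset.univ.filter (fun i => GPV.L u i ∉ S)).card
    (Finset.univ.filter (fun i => GPV.L u i ∈ S)).card with hmaj | hmaj
  · exact Or.inl (h.separated_of_majority hn0 hV (h.xzero_yzero_separated hn0 hV) u hmaj)
  · have hc := h.compl.separated_of_majority hn0 hV (h.compl.xzero_yzero_separated hn0 hV) u
      (by simpa using hmaj)
    simp only [Finset.mem_compl, not_not] at hc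
    exact Or.inr hc.symm

end QAOA
end
end

section
/- Let b(n0) = (10000·n0⁴ + n0·(11n0+1) + 1) + 10·n0²·(n0+1). Then MAXCUT(G) = ⌊ (MAXCUT(G') − b(n0)) / (n0+1) ⌋; that is, the maximum cut value of the original graph G is recovered from that of G' by subtracting b(n0), dividing by n0+1, and taking the floor. -/
/-!
STATEMENT 10: recovery of MAXCUT(G) from MAXCUT(G′) by subtracting
b(n₀) = (10000 n₀⁴ + n₀(11 n₀ + 1) + 1) + 10 n₀²(n₀ + 1), dividing by n₀+1, and
taking the floor (floor division on ℤ).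
-/
noncomputable section

namespace QAOA

/-- The indicator that the pair `a, b` is separated by `S`. -/
def sep {W : Type} [DecidableEq W] (S : Finset W) (a b : W) : ℕ :=
  if (a ∈ S ↔ b ∈ S) then 0 else 1

/-- The indicator that `a` lies in `S` and `b` does not. -/
def leave {W : Type} [DecidableEq W] (S : Finset W) (a b : W) : ℕ :=
  if a ∈ S ∧ b ∉ S then 1 else 0

section Sep

variable {W : Type} [DecidableEq W] (S : Finset W) (a b c : W)

theorem sep_le_one : sep S a b ≤ 1 := by
  unfold sep; split_ifs <;> simp

theorem leave_add_leave : leave S a b + leave S b a = sep S a b := by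
  unfold sep leave; by_cases a ∈ S <;> by_cases b ∈ S <;> simp [*]

theorem sep_add_sep_of_sep {S : Finset W} {a b : W} (h : ¬(a ∈ S ↔ b ∈ S)) :
    sep S a c + sep S b c = 1 := by
  unfold sep; by_cases a ∈ S <;> by_cases b ∈ S <;> by_cases c ∈ S <;> simp_all

end Sep

theorem cutSet_eq_sum {W : Type} [Fintype W] [DecidableEq W] (H : SimpleGraph W)
    [DecidableRel H.Adj] (S : Finset W) :
    cutSet H S = ∑ a, ∑ b, if H.Adj a b then leave S a b else 0 := by
  simp only [cutSet, leave, Finset.card_filter, Fintype.sum_prod_type, ite_and]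

theorem cutSet_le_maxCut {W : Type} [Fintype W] [DecidableEq W] (H : SimpleGraph W)
    [DecidableRel H.Adj] (S : Finset W) : cutSet H S ≤ maxCut H :=
  Finset.le_sup (f := fun S => cutSet H S) (Finset.mem_univ S)

theorem exists_cutSet_eq_maxCut {W : Type} [Fintype W] [DecidableEq W] (H : SimpleGraph W)
    [DecidableRel H.Adj] : ∃ S, cutSet H S = maxCut H := by
  obtain ⟨S, -, hS⟩ := Finset.exists_mem_eq_sup (Finset.univ : Finset (Finset W))
    Finset.univ_nonempty (fun S => cutSet H S)
  exact ⟨S, hS.symm⟩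

/-- `GPV V n0` as a sum of its five kinds of vertices. -/
def GPV.equivSum (V : Type) (n0 : ℕ) :
    GPV V n0 ≃ ((V × Fin (n0 + 1)) ⊕ (V × Fin (10 * n0))) ⊕
      ((Fin (100 * n0 * n0) ⊕ Fin (100 * n0 * n0)) ⊕ Unit) where
  toFun
    | .L u i => .inl (.inl (u, i))
    | .R u i => .inl (.inr (u, i))
    | .X i => .inr (.inl (.inl i))
    | .Y i => .inr (.inl (.inr i))
    | .W => .inr (.inr ())
  invFun
    | .inl (.inl (u, i)) => .L u i
    | .inl (.inr (u, i)) => .R u i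
    | .inr (.inl (.inl i)) => .X i
    | .inr (.inl (.inr i)) => .Y i
    | .inr (.inr ()) => .W
  left_inv := by rintro (_ | _ | _ | _ | _) <;> rfl
  right_inv := by rintro ((⟨_, _⟩ | ⟨_, _⟩) | ((_ | _) | ⟨⟩)) <;> rfl

theorem GPV.sum_eq {V : Type} [Fintype V] [DecidableEq V] {n0 : ℕ} (f : GPV V n0 → ℕ) :
    ∑ a, f a = ((∑ u, ∑ i, f (.L u i)) + ∑ u, ∑ i, f (.R u i)) +
      (((∑ i, f (.X i)) + ∑ i, f (.Y i)) + f .W) := by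
  rw [← (GPV.equivSum V n0).symm.sum_comp]
  simp [Fintype.sum_sum_type, Fintype.sum_prod_type, GPV.equivSum]

section Formula

variable {V : Type} [Fintype V] [DecidableEq V] {n0 : ℕ} (G : SimpleGraph V) [DecidableRel G.Adj]

theorem cutSet_Gp (h : 0 < n0) (S : Finset (GPV V n0)) :
    cutSet (Gp n0 G) S =
      (∑ u, ∑ i, ∑ j, sep S (.L u i) (.R u j))
      + (∑ i, cutSet G {u | GPV.L u i ∈ S})
      + (∑ i, ∑ j, sep S (.X i) (.Y j))
      + (∑ u, ∑ i, (sep S (xzero V n0 h) (.L u i) + sep S (yzero V n0 h) (.L u i)))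
      + (∑ u, ∑ i, (sep S (xzero V n0 h) (.R u i) + sep S (yzero V n0 h) (.R u i)))
      + (sep S (xzero V n0 h) .W + sep S (yzero V n0 h) .W)
      + ∑ u, sep S .W (.L u 0) := by
  have hM : 0 < 100 * n0 * n0 := Nat.mul_pos (Nat.mul_pos (by norm_num) h) h
  have e0 (i : Fin (100 * n0 * n0)) : (i : ℕ) = 0 ↔ i = ⟨0, hM⟩ := by simp [Fin.ext_iff]
  have e1 (i : Fin (n0 + 1)) : (i : ℕ) = 0 ↔ i = 0 := Fin.val_eq_zero_iff
  have hLL (u v : V) (i j : Fin (n0 + 1)) :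
      (Gp n0 G).Adj (.L u i) (.L v j) ↔ i = j ∧ G.Adj u v := by
    simp only [Gp, SimpleGraph.fromRel_adj, gpRel, ne_eq, GPV.L.injEq, Bool.and_eq_true,
      decide_eq_true_eq, beq_iff_eq, ← Fin.ext_iff, G.adj_comm v u]
    constructor
    · tauto
    · rintro ⟨rfl, hh⟩
      exact ⟨fun e => hh.ne e.1, Or.inl ⟨hh, rfl⟩⟩
  have hsync : (∑ u, ∑ i : Fin (n0 + 1), ∑ v, ∑ j : Fin (n0 + 1),
      if i = j ∧ G.Adj u v then leave S (.L u i) (.L v j) else 0) =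
      ∑ i, cutSet G {u | GPV.L u i ∈ S} := by
    rw [Finset.sum_comm]
    refine Finset.sum_congr rfl fun i _ => ?_
    simp [cutSet_eq_sum, ite_and, leave]
  rw [cutSet_eq_sum]
  simp only [GPV.sum_eq, hLL, Finset.sum_add_distrib, hsync]
  simp only [Gp, SimpleGraph.fromRel_adj, gpRel]
  simp [e0, e1, ← leave_add_leave, Finset.sum_add_distrib, xzero, yzero]
  rw [Finset.sum_comm (f := fun x y => leave S (.Y x) (.X y)),
    Finset.sum_congr rfl fun u _ => Finset.sum_comm (f := fun x y => leave S (.R u x) (.L u y))]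
  ring

end Formula

/-- If some `x k` and `y k` are on the same side of `S`, then at least `m` of the `m * m` pairs
`x i, y j` are not separated by `S`. -/
theorem sum_sep_add_le {W : Type} [DecidableEq W] {m : ℕ} (S : Finset W) (x y : Fin m → W)
    (k : Fin m) (hk : x k ∈ S ↔ y k ∈ S) :
    ∑ i, ∑ j, sep S (x i) (y j) + m ≤ m * m := by
  let same : Finset (Fin m × Fin m) := {p | x p.1 ∈ S ↔ y p.2 ∈ S}
  let f : Fin m → Fin m × Fin m := fun i =>
    if (x i ∈ S ↔ y i ∈ S) then (i, i) else if (x i ∈ S ↔ y k ∈ S) then (i, k) else (k, i)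
  have hm : m ≤ same.card := by
    have := Finset.card_le_card_of_injOn (s := Finset.univ) (t := same) f
      (fun i _ => by simp only [f, same]; split_ifs <;> simp <;> tauto)
      (fun i _ j _ hij => by simp only [f] at hij; split_ifs at hij <;> grind)
    simpa using this
  have hsum : ∑ i, ∑ j, sep S (x i) (y j) + same.card = m * m := by
    rw [Finset.card_filter, Fintype.sum_prod_type, ← Finset.sum_add_distrib]
    simp only [← Finset.sum_add_distrib]
    have (i j : Fin m) : sep S (x i) (y j) + (if (x i ∈ S ↔ y j ∈ S) then 1 else 0) = 1 := by
      unfold sep; split_ifs <;> rfl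
    simp [this]
  omega

theorem sum_sep_le {W α β : Type} [DecidableEq W] [Fintype α] [Fintype β] (S : Finset W)
    (x y : α → β → W) :
    ∑ i, ∑ j, sep S (x i j) (y i j) ≤ Fintype.card α * Fintype.card β := by
  calc ∑ i, ∑ j, sep S (x i j) (y i j) ≤ ∑ _i : α, ∑ _j : β, 1 :=
        Finset.sum_le_sum fun _ _ => Finset.sum_le_sum fun _ _ => sep_le_one ..
    _ = _ := by simp

section Bounds

variable {V : Type} [Fintype V] [DecidableEq V] {n0 : ℕ} (G : SimpleGraph V) [DecidableRel G.Adj]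

theorem frame_le (h : 0 < n0) (hV : Fintype.card V = n0) (S : Finset (GPV V n0)) :
    (∑ i, ∑ j, sep S (.X i) (.Y j))
      + (∑ u, ∑ i, (sep S (xzero V n0 h) (.L u i) + sep S (yzero V n0 h) (.L u i)))
      + (∑ u, ∑ i, (sep S (xzero V n0 h) (.R u i) + sep S (yzero V n0 h) (.R u i)))
      + (sep S (xzero V n0 h) .W + sep S (yzero V n0 h) .W) ≤
    10000 * n0 ^ 4 + n0 * (11 * n0 + 1) + 1 := by
  by_cases hs : xzero V n0 h ∈ S ↔ yzero V n0 h ∈ S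
  · have h1 := sum_sep_add_le S (GPV.X (V := V) (n0 := n0)) GPV.Y _ hs
    have h2 := sum_sep_le S (fun _ _ => xzero V n0 h) GPV.L
    have h3 := sum_sep_le S (fun _ _ => yzero V n0 h) GPV.L
    have h4 := sum_sep_le S (fun _ _ => xzero V n0 h) GPV.R
    have h5 := sum_sep_le S (fun _ _ => yzero V n0 h) GPV.R
    have h6 := sep_le_one S (xzero V n0 h) .W
    have h7 := sep_le_one S (yzero V n0 h) .W
    simp only [Finset.sum_add_distrib]
    simp only [Fintype.card_fin, hV] at h2 h3 h4 h5
    nlinarith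
  · have h1 := sum_sep_le S (fun i _ => GPV.X (V := V) (n0 := n0) i) (fun _ j => GPV.Y j)
    simp only [Fintype.card_fin] at h1
    simp only [sep_add_sep_of_sep _ hs]
    simp only [Finset.sum_const, Finset.card_univ, Fintype.card_fin, hV, smul_eq_mul]
    nlinarith

theorem cutSet_Gp_le (h : 0 < n0) (hV : Fintype.card V = n0) (S : Finset (GPV V n0)) :
    cutSet (Gp n0 G) S ≤ (10000 * n0 ^ 4 + n0 * (11 * n0 + 1) + 1) + 10 * n0 ^ 2 * (n0 + 1)
      + (n0 + 1) * maxCut G + n0 := by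
  have hframe := frame_le h hV S
  have hgadget : ∑ u, ∑ i, ∑ j, sep S (.L u i) (.R u j) ≤ 10 * n0 ^ 2 * (n0 + 1) := by
    calc ∑ u, ∑ i, ∑ j, sep S (.L u i) (.R u j)
        ≤ ∑ _u : V, (n0 + 1) * (10 * n0) := Finset.sum_le_sum fun u _ => by
          simpa using sum_sep_le S (fun i _ => GPV.L u i) (fun _ j => GPV.R u j)
      _ = 10 * n0 ^ 2 * (n0 + 1) := by simp [hV]; ring
  have hsync : ∑ i, cutSet G {u | GPV.L u i ∈ S} ≤ (n0 + 1) * maxCut G := by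
    simpa using Finset.sum_le_card_nsmul (Finset.univ : Finset (Fin (n0 + 1)))
      (fun i => cutSet G {u | GPV.L u i ∈ S}) _ fun _ _ => cutSet_le_maxCut G _
  have hcontrol : ∑ u, sep S .W (.L u 0) ≤ n0 := by
    simpa [hV] using Finset.sum_le_card_nsmul (Finset.univ : Finset V)
      (fun u => sep S .W (.L u 0)) 1 fun _ _ => sep_le_one ..
  rw [cutSet_Gp G h]
  linarith

theorem le_maxCut_Gp (h : 0 < n0) (hV : Fintype.card V = n0) :
    (10000 * n0 ^ 4 + n0 * (11 * n0 + 1) + 1) + 10 * n0 ^ 2 * (n0 + 1)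
      + (n0 + 1) * maxCut G ≤ maxCut (Gp n0 G) := by
  obtain ⟨T, hT⟩ := exists_cutSet_eq_maxCut G
  let side : GPV V n0 → Bool
    | .L u _ => u ∈ T
    | .R u _ => u ∉ T
    | .X _ => true
    | .Y _ => false
    | .W => false
  let S : Finset (GPV V n0) := {a | side a}
  have hL (u : V) (i) : GPV.L u i ∈ S ↔ u ∈ T := by simp [S, side]
  have hR (u : V) (i) : GPV.R u i ∈ S ↔ u ∉ T := by simp [S, side]
  have hX (i) : GPV.X i ∈ S := by simp [S, side]
  have hY (i) : GPV.Y i ∉ S := by simp [S, side]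
  have hs : ¬(xzero V n0 h ∈ S ↔ yzero V n0 h ∈ S) := by simp [xzero, yzero, hX, hY]
  have hLR (u : V) (i j) : sep S (.L u i) (.R u j) = 1 := by simp [sep, hL, hR]
  have hXY (i j) : sep S (.X i) (.Y j) = 1 := by simp [sep, hX, hY]
  refine le_trans ?_ (cutSet_le_maxCut (Gp n0 G) S)
  rw [cutSet_Gp G h]
  simp only [sep_add_sep_of_sep _ hs, hLR, hXY, hL, Finset.filter_univ_mem, hT, Finset.sum_const,
    Finset.card_univ, Fintype.card_fin, hV, smul_eq_mul]
  have := Nat.zero_le (∑ u, sep S .W (.L u 0))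
  linarith

end Bounds

theorem maxcut_recovery
    (n0 : ℕ) (hn0 : 0 < n0) {V : Type} [Fintype V] [DecidableEq V]
    (hV : Fintype.card V = n0) (G : SimpleGraph V) [DecidableRel G.Adj] :
    (maxCut G : ℤ) =
      Int.fdiv ((maxCut (Gp n0 G) : ℤ) -
          (((10000 * (n0 : ℤ) ^ 4 + (n0 : ℤ) * (11 * (n0 : ℤ) + 1) + 1)
            + 10 * (n0 : ℤ) ^ 2 * ((n0 : ℤ) + 1))))
        ((n0 : ℤ) + 1) := by
  have hlower := le_maxCut_Gp G hn0 hV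
  obtain ⟨S, hS⟩ := exists_cutSet_eq_maxCut (Gp n0 G)
  have hupper := cutSet_Gp_le G hn0 hV S
  rw [hS] at hupper
  zify at hlower hupper
  rw [Int.fdiv_eq_ediv_of_nonneg _ (by positivity), eq_comm,
    Int.ediv_eq_iff_of_pos (by positivity)]
  constructor <;> nlinarith

end QAOA
end
end
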